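/- Let w be a Kreweras word of length 3n. Then σ_{evac*(w)} = rc(σ_w^{-1}), i.e., σ_{evac*(w)}(i) = 3n+1 − σ_w^{-1}(3n+1−i) for all i ∈ {1,…,3n}, and ε_{evac*(w)}(i) = ε_w(3n+1−i) for all i ∈ {1,…,3n}. -/

import Mathlib

/-- The three letters of a Kreweras word. -/
inductive KLetter : Type
  | A | B | C
deriving DecidableEq, Repr

open KLetter

/-- `w` is a Kreweras word of length `3 * n`: it has `n` `A`'s, `n` `B`'s, `n` `C`'s,
and every prefix has at least as many `A`'s as `B`'s and at least as many `A`'s as `C`'s. -/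
def IsKrewerasWord (n : ℕ) (w : List KLetter) : Prop :=
  w.length = 3 * n ∧ w.count A = n ∧ w.count B = n ∧ w.count C = n ∧
  ∀ k : ℕ, (w.take k).count B ≤ (w.take k).count A ∧
           (w.take k).count C ≤ (w.take k).count A

/-- `kiota w` is the smallest index `ι ≥ 1` (1-indexed) such that the prefix of
length `ι` of `w` has equally many `A`'s as `B`'s, or equally many `A`'s as `C`'s
(and `0` if no such index exists). -/
def kiota (w : List KLetter) : ℕ :=
  (((List.range (w.length + 1)).filter fun k =>
      decide (1 ≤ k) &&
      (((w.take k).count A == (w.take k).count B) ||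
       ((w.take k).count A == (w.take k).count C))).headD 0)

/-- Promotion of a Kreweras word:
`pro w = (w₂, …, w_{ι-1}, A, w_{ι+1}, …, w_{3n}, w_ι)` where `ι = kiota w`. -/
def pro (w : List KLetter) : List KLetter :=
  ((w.drop 1).set (kiota w - 2) A) ++ [w.getD (kiota w - 1) A]

/-- The trip permutation `σ_w` of a Kreweras word of length `3 * n`, as a function on
1-indexed positions: `σ_w i` is the unique element of `{1, …, 3n}` congruent to
`kiota (pro^[i-1] w) + i - 1` modulo `3 * n`. -/
def ksigma (n : ℕ) (w : List KLetter) (i : ℕ) : ℕ :=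
  (kiota (pro^[i - 1] w) + i - 2) % (3 * n) + 1

/-- `keps w i` is the letter of `pro^[i-1] w` in (1-indexed) position `kiota (pro^[i-1] w)`. -/
def keps (w : List KLetter) (i : ℕ) : KLetter :=
  (pro^[i - 1] w).getD (kiota (pro^[i - 1] w) - 1) A

/-- The negation swapping `B` and `C` (and fixing `A`). -/
def negL : KLetter → KLetter
  | A => A
  | B => C
  | C => B

open Classical in
/-- The involution `τ_i` on Kreweras words of length `3 * n`: swap the letters in
(1-indexed) positions `i` and `i + 1` if the result is again a Kreweras word,
and otherwise do nothing. -/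
noncomputable def tau (n i : ℕ) (w : List KLetter) : List KLetter :=
  let w' := (w.set (i - 1) (w.getD i A)).set i (w.getD (i - 1) A)
  if IsKrewerasWord n w' then w' else w

/-- `tauDown n j = τ_j ∘ τ_{j-1} ∘ ⋯ ∘ τ_1`. -/
noncomputable def tauDown (n : ℕ) : ℕ → List KLetter → List KLetter
  | 0, w => w
  | j + 1, w => tau n (j + 1) (tauDown n j w)

/-- `evacAux n j = (tauDown n 1) ∘ (tauDown n 2) ∘ ⋯ ∘ (tauDown n j)`. -/
noncomputable def evacAux (n : ℕ) : ℕ → List KLetter → List KLetter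
  | 0, w => w
  | j + 1, w => evacAux n j (tauDown n (j + 1) w)

/-- Evacuation on Kreweras words of length `3 * n`:
`evac = (τ_1) ∘ (τ_2 ∘ τ_1) ∘ ⋯ ∘ (τ_{3n-1} ∘ ⋯ ∘ τ_2 ∘ τ_1)`. -/
noncomputable def evac (n : ℕ) (w : List KLetter) : List KLetter :=
  evacAux n (3 * n - 1) w

/-- `tauAsc n k c = τ_{k+c-1} ∘ ⋯ ∘ τ_{k+1} ∘ τ_k`. -/
noncomputable def tauAsc (n k : ℕ) : ℕ → List KLetter → List KLetter
  | 0, w => w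
  | j + 1, w => tau n (k + j) (tauAsc n k j w)

/-- `evacStarAux n j = (tauAsc n 1 (3n-1)) ∘ (tauAsc n 2 (3n-2)) ∘ ⋯ ∘ (tauAsc n j (3n-j))`. -/
noncomputable def evacStarAux (n : ℕ) : ℕ → List KLetter → List KLetter
  | 0, w => w
  | j + 1, w => evacStarAux n j (tauAsc n (j + 1) (3 * n - (j + 1)) w)

/-- Dual evacuation on Kreweras words of length `3 * n`:
`evac* = (τ_{3n-1} ∘ ⋯ ∘ τ_1) ∘ (τ_{3n-1} ∘ ⋯ ∘ τ_2) ∘ ⋯ ∘ (τ_{3n-1})`. -/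
noncomputable def evacStar (n : ℕ) (w : List KLetter) : List KLetter :=
  evacStarAux n (3 * n - 1) w

/-- The three-element "V"-shaped poset: `a < b`, `a < c`, with `b`, `c` incomparable. -/
inductive VP : Type
  | a | b | c
deriving DecidableEq

instance : PartialOrder VP where
  le x y := x = y ∨ x = VP.a
  le_refl x := Or.inl rfl
  le_trans x y z hxy hyz := by
    rcases hxy with rfl | rfl
    · exact hyz
    · exact Or.inr rfl
  le_antisymm x y hxy hyx := by
    rcases hxy with rfl | rfl
    · rfl
    · rcases hyx with rfl | rfl <;> rfl

/-- The labeling of elements of `V(n) = VP × Fin n` by letters. -/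
def vlabel {n : ℕ} (p : VP × Fin n) : KLetter :=
  match p.1 with
  | VP.a => A
  | VP.b => B
  | VP.c => C

/-- `L` is a linear extension of `V(n) = VP × Fin n` (with the product order):
a list of all elements of `V(n)`, each appearing once, such that `L_i ≤ L_j`
implies `i ≤ j`. -/
def IsLinearExtension (n : ℕ) (L : List (VP × Fin n)) : Prop :=
  L.Nodup ∧ (∀ p : VP × Fin n, p ∈ L) ∧
  ∀ i j : Fin L.length, L.get i ≤ L.get j → (i : ℕ) ≤ (j : ℕ)

/-- A connected Kreweras word: a Kreweras word of length `3 * n` having no proper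
nonempty consecutive substring which is itself a Kreweras word. -/
def ConnectedKrewerasWord (n : ℕ) (w : List KLetter) : Prop :=
  IsKrewerasWord n w ∧
  ∀ (u : List KLetter) (m : ℕ), u <:+: w → u ≠ [] → u ≠ w → ¬ IsKrewerasWord m u

/-- Left pass condition of the trip from position `p` at stage `k`. -/
def TPassL (f g : ℕ → ℤ) (lo p : ℕ) (k : ℕ) : Prop :=
  ∃ i, lo ≤ i ∧ i ≤ p ∧ g i ≤ g (p+1) - k - 1 ∧ ∀ i', i < i' → i' ≤ p → f (p+1) - k < f i'

/-- Right pass condition of the trip from position `p` at stage `k`. -/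
def TPassR (f g : ℕ → ℤ) (hi p : ℕ) (k : ℕ) : Prop :=
  ∃ j, p + 1 ≤ j ∧ j ≤ hi ∧ f j ≤ f (p+1) - k - 1 ∧
    ∀ j', p + 1 ≤ j' → j' ≤ j → g (p+1) - k ≤ g j'

/-- The trip ends at an opening letter `e` on the left at stage `k`. -/
def TEndA (f g : ℕ → ℤ) (lo p e : ℕ) (k : ℕ) : Prop :=
  lo ≤ e ∧ e ≤ p ∧ f e ≤ f (p+1) - k ∧ (∀ i, e < i → i ≤ p → f (p+1) - k < f i) ∧
    ∀ i, e ≤ i → i ≤ p → g (p+1) - k ≤ g i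

/-- The trip ends at a closing letter `e` on the right at stage `k`. -/
def TEndC (f g : ℕ → ℤ) (lo hi p e : ℕ) (k : ℕ) : Prop :=
  TPassL f g lo p k ∧ p + 1 ≤ e ∧ e + 1 ≤ hi ∧ g (e+1) ≤ g (p+1) - k - 1 ∧
    (∀ i, p + 1 ≤ i → i ≤ e → g (p+1) - k ≤ g i) ∧
    ∀ i, p + 1 ≤ i → i ≤ e + 1 → f (p+1) - k ≤ f i

/-- The trip from a closing letter at position `p` ends at `e`. -/
def TripB (f g : ℕ → ℤ) (lo hi p e : ℕ) : Prop :=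
  ∃ k : ℕ, (∀ k', k' < k → TPassL f g lo p k' ∧ TPassR f g hi p k') ∧
    (TEndA f g lo p e k ∨ TEndC f g lo hi p e k)

theorem trip_case1 (N t p e : ℕ) (f g F G : ℕ → ℤ) (ht1 : 1 ≤ t) (htN : t < N) (hpN : p < N)
    (hf0 : ∀ i, i ≤ N → 0 ≤ f i)
    (hft : f (t+1) = 0)
    (hF2 : ∀ i, t < i → i ≤ N → F i = f i + 1) (hG2 : ∀ i, t < i → i ≤ N → G i = g i)
    (htp : t < p) (h : TripB f g 0 N p e) : TripB F G 1 (N+1) p e ∧ e ≠ 0 := by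
  obtain ⟨k, hk, hend⟩ := h
  have hX : F (p+1) = f (p+1) + 1 := hF2 _ (by omega) (by omega)
  have hY : G (p+1) = g (p+1) := hG2 _ (by omega) (by omega)
  have hX0 := hf0 (p+1) (by omega)
  have kle : (k:ℤ) ≤ f (p+1) := by
    rcases Nat.eq_zero_or_pos k with h0 | h0
    · subst h0; simpa using hX0
    · obtain ⟨_, j, hj1, hj2, hj3, _⟩ := hk (k-1) (by omega)
      have := hf0 j hj2
      omega
  have pL : ∀ k', k' ≤ k → TPassL f g 0 p k' → TPassL F G 1 p k' := by
    rintro k' hk' ⟨i, _, hi, hgi, hfi⟩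
    have hit : t < i := by
      by_contra hc
      have := hfi (t+1) (by omega) (by omega)
      omega
    refine ⟨i, by omega, hi, ?_, ?_⟩
    · rw [hG2 i hit (by omega)]; omega
    · intro i' h1 h2
      rw [hF2 i' (by omega) (by omega)]
      have := hfi i' h1 h2
      omega
  have pR : ∀ k', TPassR f g N p k' → TPassR F G (N+1) p k' := by
    rintro k' ⟨j, h1, h2, h3, h4⟩
    refine ⟨j, h1, by omega, ?_, ?_⟩
    · rw [hF2 j (by omega) h2]; omega
    · intro j' h5 h6
      rw [hG2 j' (by omega) (by omega)]
      have := h4 j' h5 h6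
      omega
  rcases hend with ⟨_, h2, h3, h4, h5⟩ | ⟨hl, h1, h2, h3, h4, h5⟩
  · have hte : t < e := by
      by_contra hc
      have := h4 (t+1) (by omega) (by omega)
      omega
    refine ⟨⟨k, fun k' hk' => ⟨pL k' hk'.le (hk k' hk').1, pR k' (hk k' hk').2⟩, Or.inl ?_⟩, by omega⟩
    refine ⟨by omega, h2, ?_, ?_, ?_⟩
    · rw [hF2 e hte (by omega)]; omega
    · intro i h6 h7
      rw [hF2 i (by omega) (by omega)]
      have := h4 i h6 h7; omega
    · intro i h6 h7
      rw [hG2 i (by omega) (by omega)]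
      have := h5 i h6 h7; omega
  · refine ⟨⟨k, fun k' hk' => ⟨pL k' hk'.le (hk k' hk').1, pR k' (hk k' hk').2⟩, Or.inr ?_⟩, by omega⟩
    refine ⟨pL k le_rfl hl, h1, by omega, ?_, ?_, ?_⟩
    · rw [hG2 _ (by omega) h2]; omega
    · intro i h6 h7
      rw [hG2 i (by omega) (by omega)]
      have := h4 i h6 h7; omega
    · intro i h6 h7
      rw [hF2 i (by omega) (by omega)]
      have := h5 i h6 h7; omega

theorem trip_case2 (N t p e : ℕ) (f g F G : ℕ → ℤ) (ht1 : 1 ≤ t) (htN : t < N) (hpN : p < N)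
    (hf0 : ∀ i, i ≤ N → 0 ≤ f i) (hg0 : ∀ i, i ≤ N → 0 ≤ g i)
    (hf00 : f 0 = 0) (hfN : f N = 0)
    (hfp : ∀ i, 1 ≤ i → i ≤ t → 1 ≤ f i)
    (hgp : ∀ i, 1 ≤ i → i ≤ t → 1 ≤ g i)
    (hgt : g (t+1) = 0) (hgt1 : g t = 1) (hf1 : f 1 = 1)
    (hF1 : ∀ i, 1 ≤ i → i ≤ t → F i = f i - 1) (hG1 : ∀ i, 1 ≤ i → i ≤ t → G i = g i - 1)
    (hF2 : ∀ i, t < i → i ≤ N → F i = f i) (hG2 : ∀ i, t < i → i ≤ N → G i = g i + 1)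
    (hFe : F (N+1) = 0) (hGe : G (N+1) = 0)
    (htp : t < p) (h : TripB f g 0 N p e) : TripB F G 1 (N+1) p (if e = 0 then N else e) := by
  obtain ⟨k, hk, hend⟩ := h
  have hX : F (p+1) = f (p+1) := hF2 _ (by omega) (by omega)
  have hY : G (p+1) = g (p+1) + 1 := hG2 _ (by omega) (by omega)
  have hX0 := hf0 (p+1) (by omega)
  have hY0 := hg0 (p+1) (by omega)
  have kle : (k:ℤ) ≤ g (p+1) := by
    rcases Nat.eq_zero_or_pos k with h0 | h0
    · subst h0; simpa using hY0
    · obtain ⟨⟨j, _, hj2, hj3, _⟩, _⟩ := hk (k-1) (by omega)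
      have := hg0 j (by omega)
      omega
  have pL : ∀ k', TPassL f g 0 p k' → TPassL F G 1 p k' := by
    rintro k' ⟨i, _, hi, hgi, hfi⟩
    by_cases hit : t < i
    · refine ⟨i, by omega, hi, ?_, ?_⟩
      · rw [hG2 i hit (by omega)]; omega
      · intro i' h1 h2
        rw [hF2 i' (by omega) (by omega)]
        have := hfi i' h1 h2
        omega
    · have := hg0 i (by omega)
      refine ⟨t+1, by omega, by omega, ?_, ?_⟩
      · rw [hG2 _ (by omega) (by omega)]; omega
      · intro i' h1 h2
        rw [hF2 i' (by omega) (by omega)]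
        have := hfi i' (by omega) h2
        omega
  have pR : ∀ k', TPassR f g N p k' → TPassR F G (N+1) p k' := by
    rintro k' ⟨j, h1, h2, h3, h4⟩
    refine ⟨j, h1, by omega, ?_, ?_⟩
    · rw [hF2 j (by omega) h2]; omega
    · intro j' h5 h6
      rw [hG2 j' (by omega) (by omega)]
      have := h4 j' h5 h6
      omega
  rcases hend with ⟨_, h2, h3, h4, h5⟩ | ⟨hl, h1, h2, h3, h4, h5⟩
  · by_cases hte : t < e
    · rw [if_neg (by omega)]
      refine ⟨k, fun k' hk' => ⟨pL k' (hk k' hk').1, pR k' (hk k' hk').2⟩, Or.inl ?_⟩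
      refine ⟨by omega, h2, ?_, ?_, ?_⟩
      · rw [hF2 e hte (by omega)]; omega
      · intro i h6 h7
        rw [hF2 i (by omega) (by omega)]
        have := h4 i h6 h7; omega
      · intro i h6 h7
        rw [hG2 i (by omega) (by omega)]
        have := h5 i h6 h7; omega
    · have hkY : (k:ℤ) = g (p+1) := by
        have := h5 (t+1) (by omega) (by omega)
        omega
      have hPL : TPassL F G 1 p k := by
        refine ⟨t, ht1, by omega, ?_, ?_⟩
        · rw [hG1 t ht1 le_rfl]; omega
        · intro i h6 h7
          rw [hF2 i (by omega) (by omega)]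
          have := h4 i (by omega) h7; omega
      by_cases he : e = 0
      · subst he
        rw [if_pos rfl]
        have hkX : (k:ℤ) = f (p+1) := by
          have := h4 1 (by omega) (by omega)
          omega
        refine ⟨k, fun k' hk' => ⟨pL k' (hk k' hk').1, pR k' (hk k' hk').2⟩, Or.inr ?_⟩
        refine ⟨hPL, by omega, by omega, by omega, ?_, ?_⟩
        · intro i h6 h7
          rw [hG2 i (by omega) (by omega)]
          have := hg0 i h7; omega
        · intro i h6 h7
          rcases Nat.lt_or_ge N i with h8 | h8
          · have : i = N + 1 := by omega
            subst this; omega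
          · rw [hF2 i (by omega) h8]
            have := hf0 i h8; omega
      · rw [if_neg he]
        have hfe := hfp e (by omega) (by omega)
        refine ⟨k+1, ?_, Or.inl ?_⟩
        · intro k' hk'
          rcases Nat.lt_or_ge k' k with h8 | h8
          · exact ⟨pL k' (hk k' h8).1, pR k' (hk k' h8).2⟩
          · have : k' = k := by omega
            subst this
            refine ⟨hPL, N, by omega, by omega, ?_, ?_⟩
            · rw [hF2 N htN le_rfl]; omega
            · intro j h6 h7
              rw [hG2 j (by omega) (by omega)]
              have := hg0 j h7; omega
        · refine ⟨by omega, h2, ?_, ?_, ?_⟩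
          · rw [hF1 e (by omega) (by omega)]; push_cast; omega
          · intro i h6 h7
            have := h4 i h6 h7
            rcases Nat.lt_or_ge t i with h8 | h8
            · rw [hF2 i h8 (by omega)]; push_cast; omega
            · rw [hF1 i (by omega) h8]; push_cast; omega
          · intro i h6 h7
            rcases Nat.lt_or_ge t i with h8 | h8
            · rw [hG2 i h8 (by omega)]
              have := hg0 i (by omega)
              push_cast; omega
            · rw [hG1 i (by omega) h8]
              have := hgp i (by omega) h8
              push_cast; omega
  · rw [if_neg (by omega)]
    refine ⟨k, fun k' hk' => ⟨pL k' (hk k' hk').1, pR k' (hk k' hk').2⟩, Or.inr ?_⟩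
    refine ⟨pL k hl, h1, by omega, ?_, ?_, ?_⟩
    · rw [hG2 _ (by omega) h2]; omega
    · intro i h6 h7
      rw [hG2 i (by omega) (by omega)]
      have := h4 i h6 h7; omega
    · intro i h6 h7
      rw [hF2 i (by omega) (by omega)]
      have := h5 i h6 h7; omega

theorem trip_case3 (N t p e : ℕ) (f g F G : ℕ → ℤ) (ht1 : 1 ≤ t) (htN : t < N) (hp1 : 1 ≤ p)
    (hf0 : ∀ i, i ≤ N → 0 ≤ f i) (hg0 : ∀ i, i ≤ N → 0 ≤ g i)
    (hf00 : f 0 = 0)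
    (hfp : ∀ i, 1 ≤ i → i ≤ t → 1 ≤ f i) (hgp : ∀ i, 1 ≤ i → i ≤ t → 1 ≤ g i)
    (hgt : g (t+1) = 0) (hgt1 : g t = 1) (hf1 : f 1 = 1)
    (hF1 : ∀ i, 1 ≤ i → i ≤ t → F i = f i - 1) (hG1 : ∀ i, 1 ≤ i → i ≤ t → G i = g i - 1)
    (htp : p < t) (h : TripB f g 0 N p e) : TripB F G 1 (N+1) p e ∧ e ≠ 0 := by
  obtain ⟨k, hk, hend⟩ := h
  have hX : F (p+1) = f (p+1) - 1 := hF1 _ (by omega) (by omega)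
  have hY : G (p+1) = g (p+1) - 1 := hG1 _ (by omega) (by omega)
  have hX1 := hfp (p+1) (by omega) (by omega)
  have hY0 := hg0 (p+1) (by omega)
  have kleY : ∀ k', TPassL f g 0 p k' → (k':ℤ) + 1 ≤ g (p+1) := by
    rintro k' ⟨i, _, hi, hgi, _⟩
    have := hg0 i (by omega)
    omega
  have notX : ∀ k' : ℕ, k' ≤ k → (k':ℤ) < f (p+1) := by
    intro k' hk'
    by_contra hc
    obtain ⟨hl, j, hj1, hj2, hj3, hj4⟩ : TPassL f g 0 p ((f (p+1)).toNat - 1) ∧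
        TPassR f g N p ((f (p+1)).toNat - 1) := hk _ (by omega)
    have h7 := kleY _ hl
    have hjt : t < j := by
      by_contra hcc
      have := hfp j (by omega) (by omega)
      omega
    have := hj4 (t+1) (by omega) (by omega)
    omega
  have pL : ∀ k', k' ≤ k → TPassL f g 0 p k' → TPassL F G 1 p k' := by
    rintro k' hk' ⟨i, _, hi, hgi, hfi⟩
    have hi0 : i ≠ 0 := by
      rintro rfl
      have := hfi 1 (by omega) (by omega)
      have := notX k' hk'
      omega
    refine ⟨i, by omega, hi, ?_, ?_⟩
    · rw [hG1 i (by omega) (by omega)]; omega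
    · intro i' h1 h2
      rw [hF1 i' (by omega) (by omega)]
      have := hfi i' h1 h2
      omega
  have pR : ∀ k', TPassL f g 0 p k' → TPassR f g N p k' → TPassR F G (N+1) p k' := by
    rintro k' hl ⟨j, h1, h2, h3, h4⟩
    have := kleY _ hl
    have hjt : j ≤ t := by
      by_contra hcc
      have := h4 (t+1) (by omega) (by omega)
      omega
    refine ⟨j, h1, by omega, ?_, ?_⟩
    · rw [hF1 j (by omega) hjt]; omega
    · intro j' h5 h6
      rw [hG1 j' (by omega) (by omega)]
      have := h4 j' h5 h6
      omega
  have pp : ∀ k', k' < k → TPassL F G 1 p k' ∧ TPassR F G (N+1) p k' :=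
    fun k' hk' => ⟨pL k' hk'.le (hk k' hk').1, pR k' (hk k' hk').1 (hk k' hk').2⟩
  have hkX := notX k le_rfl
  rcases hend with ⟨_, h2, h3, h4, h5⟩ | ⟨hl, h1, h2, h3, h4, h5⟩
  · have he0 : e ≠ 0 := by
      rintro rfl
      have := h4 1 (by omega) (by omega)
      omega
    refine ⟨⟨k, pp, Or.inl ⟨by omega, h2, ?_, ?_, ?_⟩⟩, he0⟩
    · rw [hF1 e (by omega) (by omega)]; omega
    · intro i h6 h7
      rw [hF1 i (by omega) (by omega)]
      have := h4 i h6 h7; omega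
    · intro i h6 h7
      rw [hG1 i (by omega) (by omega)]
      have := h5 i h6 h7; omega
  · have h9 := kleY _ hl
    have het : e + 1 ≤ t := by
      by_contra hcc
      rcases Nat.lt_or_ge t e with h8 | h8
      · have := h4 (t+1) (by omega) (by omega)
        omega
      · have : e = t := by omega
        subst this
        have := h4 e (by omega) le_rfl
        obtain ⟨i, _, hi, hgi, hfi⟩ := hl
        have hi0 : i = 0 := by
          by_contra hi0
          have := hgp i (by omega) (by omega)
          omega
        subst hi0
        have := hfi 1 (by omega) (by omega)
        omega
    refine ⟨⟨k, pp, Or.inr ⟨pL k le_rfl hl, h1, by omega, ?_, ?_, ?_⟩⟩, by omega⟩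
    · rw [hG1 _ (by omega) het]; omega
    · intro i h6 h7
      rw [hG1 i (by omega) (by omega)]
      have := h4 i h6 h7; omega
    · intro i h6 h7
      rw [hF1 i (by omega) (by omega)]
      have := h5 i h6 h7; omega

theorem trip_case4 (N t p e : ℕ) (f g F G : ℕ → ℤ) (ht1 : 1 ≤ t) (htN : t < N) (hp1 : 1 ≤ p)
    (hf0 : ∀ i, i ≤ N → 0 ≤ f i)
    (hf00 : f 0 = 0) (hg00 : g 0 = 0)
    (hfp : ∀ i, 1 ≤ i → i ≤ t → 1 ≤ f i) (hgp : ∀ i, 1 ≤ i → i ≤ t → 1 ≤ g i)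
    (hft : f (t+1) = 0) (hft1 : f t = 1) (hf1 : f 1 = 1)
    (hF1 : ∀ i, 1 ≤ i → i ≤ t → F i = f i - 1) (hG1 : ∀ i, 1 ≤ i → i ≤ t → G i = g i - 1)
    (hF2 : ∀ i, t < i → i ≤ N → F i = f i + 1) (hG2 : ∀ i, t < i → i ≤ N → G i = g i)
    (htp : p < t) (h : TripB f g 0 N p e) : TripB F G 1 (N+1) p e ∧ e ≠ 0 := by
  obtain ⟨k, hk, hend⟩ := h
  have hX : F (p+1) = f (p+1) - 1 := hF1 _ (by omega) (by omega)
  have hY : G (p+1) = g (p+1) - 1 := hG1 _ (by omega) (by omega)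
  have hX1 := hfp (p+1) (by omega) (by omega)
  have pL : ∀ k' : ℕ, (k':ℤ) < f (p+1) → TPassL f g 0 p k' → TPassL F G 1 p k' := by
    rintro k' hk' ⟨i, _, hi, hgi, hfi⟩
    have hi0 : i ≠ 0 := by
      rintro rfl
      have := hfi 1 (by omega) (by omega)
      omega
    refine ⟨i, by omega, hi, ?_, ?_⟩
    · rw [hG1 i (by omega) (by omega)]; omega
    · intro i' h1 h2
      rw [hF1 i' (by omega) (by omega)]
      have := hfi i' h1 h2
      omega
  have pR : ∀ k' : ℕ, (k':ℤ) + 1 < f (p+1) → TPassR f g N p k' → TPassR F G (N+1) p k' := by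
    rintro k' hk' ⟨j, h1, h2, h3, h4⟩
    rcases Nat.lt_or_ge t j with hjt | hjt
    · refine ⟨t, by omega, by omega, ?_, ?_⟩
      · rw [hF1 t (by omega) le_rfl]; omega
      · intro j' h5 h6
        rw [hG1 j' (by omega) (by omega)]
        have := h4 j' h5 (by omega)
        omega
    · refine ⟨j, h1, by omega, ?_, ?_⟩
      · rw [hF1 j (by omega) hjt]; omega
      · intro j' h5 h6
        rw [hG1 j' (by omega) (by omega)]
        have := h4 j' h5 h6
        omega
  have pp : ∀ k', k' < k → (k':ℤ) + 1 < f (p+1) → TPassL F G 1 p k' ∧ TPassR F G (N+1) p k' :=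
    fun k' hk' h8 => ⟨pL k' (by omega) (hk k' hk').1, pR k' h8 (hk k' hk').2⟩
  rcases hend with ⟨_, h2, h3, h4, h5⟩ | ⟨hl, h1, h2, h3, h4, h5⟩
  · have he0 : e ≠ 0 := by
      rintro rfl
      have h6 := h4 1 (by omega) (by omega)
      have h7 := h5 0 (by omega) (by omega)
      obtain ⟨⟨i, _, hi, hgi, hfi⟩, _⟩ := hk (k-1) (by omega)
      have hi0 : i = 0 := by
        by_contra hi0
        have := hgp i (by omega) (by omega)
        omega
      subst hi0
      have := hfi 1 (by omega) (by omega)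
      omega
    have := hfp e (by omega) (by omega)
    refine ⟨⟨k, fun k' hk' => pp k' hk' (by omega), Or.inl ⟨by omega, h2, ?_, ?_, ?_⟩⟩, he0⟩
    · rw [hF1 e (by omega) (by omega)]; omega
    · intro i h6 h7
      rw [hF1 i (by omega) (by omega)]
      have := h4 i h6 h7; omega
    · intro i h6 h7
      rw [hG1 i (by omega) (by omega)]
      have := h5 i h6 h7; omega
  · by_cases hkX : (k:ℤ) < f (p+1)
    · have het : e + 1 ≤ t := by
        by_contra hcc
        have := h5 (t+1) (by omega) (by omega)
        omega
      refine ⟨⟨k, fun k' hk' => pp k' hk' (by omega),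
        Or.inr ⟨pL k hkX hl, h1, by omega, ?_, ?_, ?_⟩⟩, by omega⟩
      · rw [hG1 _ (by omega) het]; omega
      · intro i h6 h7
        rw [hG1 i (by omega) (by omega)]
        have := h4 i h6 h7; omega
      · intro i h6 h7
        rw [hF1 i (by omega) (by omega)]
        have := h5 i h6 h7; omega
    · obtain ⟨hl', j, hj1, hj2, hj3, hj4⟩ := hk (k-1) (by omega)
      have hkX' : (k:ℤ) = f (p+1) := by
        have := hf0 j hj2
        omega
      have hjt : t < j := by
        by_contra hcc
        have := hfp j (by omega) (by omega)
        omega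
      have hej : j < e + 1 := by
        by_contra hcc
        have := hj4 (e+1) (by omega) (by omega)
        omega
      refine ⟨⟨k-1, fun k' hk' => pp k' (by omega) (by omega),
        Or.inr ⟨pL _ (by omega) hl', h1, by omega, ?_, ?_, ?_⟩⟩, by omega⟩
      · rw [hG2 _ (by omega) h2]; omega
      · intro i h6 h7
        rcases Nat.lt_or_ge t i with h8 | h8
        · rw [hG2 i h8 (by omega)]
          have := h4 i h6 h7; omega
        · rw [hG1 i (by omega) h8]
          have := hj4 i h6 (by omega); omega
      · intro i h6 h7
        rcases Nat.lt_or_ge t i with h8 | h8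
        · rw [hF2 i h8 (by omega)]
          have := hf0 i (by omega); omega
        · rw [hF1 i (by omega) h8]
          have := hfp i (by omega) h8; omega
/-- Step of the height for letter `b`. -/
def kst (b x : KLetter) : ℤ := if x = A then 1 else if x = b then -1 else 0

/-- Height: number of `A` minus number of `b` in the prefix of length `i`. -/
def kht (w : List KLetter) (b : KLetter) (i : ℕ) : ℤ :=
  ((w.take i).count A : ℤ) - ((w.take i).count b : ℤ)

theorem kht_zero (w : List KLetter) (b : KLetter) : kht w b 0 = 0 := by simp [kht]

theorem kht_succ (w : List KLetter) (b : KLetter) (hb : b ≠ A) (i : ℕ) (hi : i < w.length) :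
    kht w b (i+1) = kht w b i + kst b (w.getD i A) := by
  unfold kht kst
  rw [List.take_add_one, List.getElem?_eq_getElem hi]
  simp only [Option.toList_some, List.count_append, List.count_singleton,
    List.getD_eq_getElem?_getD, List.getElem?_eq_getElem hi, Option.getD_some]
  generalize w[i] = x
  cases x <;> cases b <;> simp_all <;> ring

theorem count_sum (w : List KLetter) : w.count A + w.count B + w.count C = w.length := by
  induction w with
  | nil => simp
  | cons x l ih => cases x <;> simp <;> omega

theorem kw_iff (n : ℕ) (w : List KLetter) : IsKrewerasWord n w ↔
    w.length = 3 * n ∧ ∀ b, b ≠ A → (kht w b (3*n) = 0 ∧ ∀ i, i ≤ 3 * n → 0 ≤ kht w b i) := by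
  unfold IsKrewerasWord kht
  constructor
  · rintro ⟨h1, h2, h3, h4, h5⟩
    refine ⟨h1, ?_⟩
    intro b hb
    rw [List.take_of_length_le h1.le]
    cases b
    · exact absurd rfl hb
    · refine ⟨by omega, fun i _ => ?_⟩
      have := (h5 i).1; omega
    · refine ⟨by omega, fun i _ => ?_⟩
      have := (h5 i).2; omega
  · rintro ⟨h1, h2⟩
    have hB := h2 B (by decide)
    have hC := h2 C (by decide)
    rw [List.take_of_length_le h1.le] at hB hC
    have := count_sum w
    refine ⟨h1, by omega, by omega, by omega, ?_⟩
    intro k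
    rcases Nat.lt_or_ge (3*n) k with h | h
    · rw [List.take_of_length_le (by omega)]
      omega
    · have := hB.2 k h
      have := hC.2 k h
      omega

/-- `m` is the (0-indexed) position of the first return, with letter `b`. -/
structure KHit (w : List KLetter) (m : ℕ) (b : KLetter) : Prop where
  hb : b ≠ A
  m1 : 1 ≤ m
  mlt : m < w.length
  letter : w.getD m A = b
  zero : kht w b (m+1) = 0
  pos : ∀ c, c ≠ A → ∀ i, 1 ≤ i → i ≤ m → 1 ≤ kht w c i

theorem negL_ne {b : KLetter} (h : b ≠ A) : negL b ≠ A := by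
  cases b <;> simp_all [negL]

theorem negL_ne_self {b : KLetter} (h : b ≠ A) : negL b ≠ b := by
  cases b <;> simp_all [negL]

theorem eq_or_negL {b c : KLetter} (h : b ≠ A) (hc : c ≠ A) : c = b ∨ c = negL b := by
  cases b <;> cases c <;> simp_all [negL]

theorem negL_negL (b : KLetter) : negL (negL b) = b := by
  cases b <;> rfl

theorem kiota_eq_find (w : List KLetter) : kiota w =
    ((List.range (w.length + 1)).find? (fun k =>
      decide (1 ≤ k) &&
      (((w.take k).count A == (w.take k).count B) ||
       ((w.take k).count A == (w.take k).count C)))).getD 0 := by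
  unfold kiota
  rw [← List.head?_filter, List.headD_eq_head?_getD]

theorem kht_first {n : ℕ} {w : List KLetter} (hn : 1 ≤ n) (hw : IsKrewerasWord n w) :
    w.getD 0 A = A := by
  have h := (kw_iff n w).1 hw
  by_contra hc
  have h1 := (h.2 _ hc).2 1 (by omega)
  have := kht_succ w _ hc 0 (by omega)
  rw [kht_zero] at this
  simp [kst] at this
  simp [this] at h1
  split_ifs at h1 <;> simp_all

theorem exists_hit {n : ℕ} {w : List KLetter} (hn : 1 ≤ n) (hw : IsKrewerasWord n w) :
    ∃ m b, KHit w m b ∧ kiota w = m + 1 := by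
  have h := (kw_iff n w).1 hw
  have h0 := kht_first hn hw
  have hs : ∀ c, c ≠ A → kht w c 1 = 1 := by
    intro c hc
    rw [kht_succ w c hc 0 (by omega), kht_zero, h0]; simp [kst]
  rw [kiota_eq_find]
  cases hf : (List.range (w.length + 1)).find? (fun k =>
      decide (1 ≤ k) &&
      (((w.take k).count A == (w.take k).count B) ||
       ((w.take k).count A == (w.take k).count C))) with
  | none =>
    exfalso
    rw [List.find?_eq_none] at hf
    have := hf (3*n) (by simp; omega)
    have h2 := (h.2 B (by decide)).1
    unfold kht at h2
    simp at this
    omega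
  | some i =>
    rw [List.find?_range_eq_some] at hf
    obtain ⟨h1, h2, h3⟩ := hf
    simp only [Bool.and_eq_true, decide_eq_true_eq, Bool.or_eq_true, beq_iff_eq] at h1
    have hpos : ∀ c, c ≠ A → ∀ j, 1 ≤ j → j < i → 1 ≤ kht w c j := by
      intro c hc j hj1 hj2
      have h4 := h3 j hj2
      simp [hj1] at h4
      have h5 := (h.2 c hc).2 j (by simp at h2; omega)
      have h6 : kht w c j ≠ 0 := by
        unfold kht
        cases c
        · exact absurd rfl hc
        · omega
        · omega
      omega
    have hi2 : 2 ≤ i := by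
      by_contra hc
      have : i = 1 := by omega
      subst this
      have hB := hs B (by decide)
      have hC := hs C (by decide)
      unfold kht at hB hC
      omega
    simp at h2
    obtain ⟨b, hb, hz⟩ : ∃ b, b ≠ A ∧ kht w b i = 0 := by
      rcases h1.2 with h5 | h5
      · exact ⟨B, by decide, by unfold kht; omega⟩
      · exact ⟨C, by decide, by unfold kht; omega⟩
    refine ⟨i-1, b, ⟨hb, by omega, by omega, ?_, ?_, ?_⟩, by simp; omega⟩
    · have h7 := kht_succ w b hb (i-1) (by omega)
      rw [show i - 1 + 1 = i by omega, hz] at h7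
      have h8 := hpos b hb (i-1) (by omega) (by omega)
      unfold kst at h7
      split_ifs at h7 with h9 h10
      · omega
      · exact h10
      · omega
    · rw [show i - 1 + 1 = i by omega, hz]
    · intro c hc j hj1 hj2
      exact hpos c hc j hj1 (by omega)

theorem KHit.unique {w : List KLetter} {m m' : ℕ} {b b' : KLetter} (h : KHit w m b)
    (h' : KHit w m' b') : m = m' ∧ b = b' := by
  have : m = m' := by
    rcases Nat.lt_trichotomy m m' with h1 | h1 | h1
    · have := h'.pos b h.hb (m+1) (by omega) (by omega)
      have := h.zero
      omega
    · exact h1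
    · have := h.pos b' h'.hb (m'+1) (by omega) (by omega)
      have := h'.zero
      omega
  subst this
  exact ⟨rfl, h.letter.symm.trans h'.letter⟩

theorem KHit.iota {n : ℕ} {w : List KLetter} {m : ℕ} {b : KLetter} (hn : 1 ≤ n)
    (hw : IsKrewerasWord n w) (h : KHit w m b) : kiota w = m + 1 := by
  obtain ⟨m', b', h', hk⟩ := exists_hit hn hw
  rw [hk, (h.unique h').1]

theorem pro_length {n : ℕ} {w : List KLetter} (hn : 1 ≤ n) (hw : IsKrewerasWord n w) :
    (pro w).length = 3 * n := by
  have := hw.1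
  simp [pro]; omega

theorem pro_getD {n : ℕ} {w : List KLetter} {m : ℕ} {b : KLetter} (hn : 1 ≤ n)
    (hw : IsKrewerasWord n w) (h : KHit w m b) (i : ℕ) (hi : i < 3 * n - 1) :
    (pro w).getD i A = if i + 1 = m then A else w.getD (i+1) A := by
  have hk := h.iota hn hw
  have hl := hw.1
  have := h.m1
  unfold pro
  rw [hk, List.getD_append _ _ _ _ (by simp; omega)]
  simp only [List.getD_eq_getElem?_getD, List.getElem?_set, List.getElem?_drop, List.length_drop]
  split_ifs with h1 h2 h3 <;> first | omega | simp | (rw [Nat.add_comm])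

theorem pro_getD_last {n : ℕ} {w : List KLetter} {m : ℕ} {b : KLetter} (hn : 1 ≤ n)
    (hw : IsKrewerasWord n w) (h : KHit w m b) : (pro w).getD (3 * n - 1) A = b := by
  have hk := h.iota hn hw
  have hl := hw.1
  unfold pro
  rw [hk, List.getD_append_right _ _ _ _ (by simp; omega)]
  simp [hl]
  simpa using h.letter

theorem hit_one {n : ℕ} {w : List KLetter} (hn : 1 ≤ n) (hw : IsKrewerasWord n w)
    (c : KLetter) (hc : c ≠ A) : kht w c 1 = 1 := by
  have hl := hw.1
  rw [kht_succ w c hc 0 (by omega), kht_zero, kht_first hn hw]; simp [kst]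

theorem kht_at {w : List KLetter} {m : ℕ} {b : KLetter}
    (h : KHit w m b) (c : KLetter) (hc : c ≠ A) :
    kht w c (m+1) = kht w c m - (if c = b then 1 else 0) := by
  rw [kht_succ w c hc m h.mlt, h.letter]
  have := h.hb
  unfold kst
  rw [if_neg this]
  by_cases hcb : b = c
  · rw [if_pos hcb, if_pos hcb.symm]; ring
  · rw [if_neg hcb, if_neg (fun h => hcb h.symm)]; ring

/-- heights of words whose first letters agree with the promotion. -/
theorem kht_slide {n : ℕ} {w y : List KLetter} {m : ℕ} {b : KLetter} (hn : 1 ≤ n)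
    (hw : IsKrewerasWord n w) (h : KHit w m b) (c : KLetter) (hc : c ≠ A)
    (j : ℕ) (hj : j + 1 ≤ 3 * n) (hyl : y.length = 3 * n)
    (hy : ∀ i, i < j → y.getD i A = if i + 1 = m then A else w.getD (i+1) A) :
    kht y c j = if j + 1 ≤ m then kht w c (j+1) - 1 else
      kht w c (j+1) + (if c = b then 1 else 0) := by
  have hl := hw.1
  have hm := h.m1
  induction j with
  | zero =>
    rw [if_pos (by omega), kht_zero, hit_one hn hw c hc]; rfl
  | succ j ih =>
    rw [kht_succ y c hc j (by omega), ih (by omega) (fun i hi => hy i (by omega)), hy j (by omega)]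
    have h1 := kht_succ w c hc (j+1) (by omega)
    rcases Nat.lt_trichotomy (j+1) m with h2 | h2 | h2
    · rw [if_pos h2.le, if_neg (by omega), if_pos (by omega)]
      omega
    · have h3 := kht_at h c hc
      rw [if_pos h2.le, if_pos h2, if_neg (by omega)]
      rw [← h2] at h3
      rw [h3]
      simp [kst]
    · rw [if_neg (show ¬ (j + 1 ≤ m) by omega), if_neg (show ¬ (j + 1 = m) by omega),
        if_neg (show ¬ (j + 1 + 1 ≤ m) by omega)]
      omega

theorem pro_kht {n : ℕ} {w : List KLetter} {m : ℕ} {b : KLetter} (hn : 1 ≤ n)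
    (hw : IsKrewerasWord n w) (h : KHit w m b) (c : KLetter) (hc : c ≠ A)
    (j : ℕ) (hj : j + 1 ≤ 3 * n)  :
    kht (pro w) c j = if j + 1 ≤ m then kht w c (j+1) - 1 else
      kht w c (j+1) + (if c = b then 1 else 0) :=
  kht_slide hn hw h c hc j hj (pro_length hn hw) (fun i hi => pro_getD hn hw h i (by omega))

theorem pro_kht_last {n : ℕ} {w : List KLetter} {m : ℕ} {b : KLetter} (hn : 1 ≤ n)
    (hw : IsKrewerasWord n w) (h : KHit w m b) (c : KLetter) (hc : c ≠ A) :
    kht (pro w) c (3*n) = 0 := by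
  have hl := hw.1
  have hm := h.mlt
  have h1 := kht_succ (pro w) c hc (3*n-1) (by rw [pro_length hn hw]; omega)
  rw [show 3*n-1+1 = 3*n by omega] at h1
  rw [h1, pro_kht hn hw h c hc _ (by omega), if_neg (by omega), pro_getD_last hn hw h,
    show 3*n-1+1 = 3*n by omega, (((kw_iff n w).1 hw).2 c hc).1]
  unfold kst
  rw [if_neg h.hb]
  by_cases hcb : b = c
  · rw [if_pos hcb, if_pos hcb.symm]; ring
  · rw [if_neg hcb, if_neg (fun h => hcb h.symm)]; ring

theorem pro_kw {n : ℕ} {w : List KLetter} (hn : 1 ≤ n) (hw : IsKrewerasWord n w) :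
    IsKrewerasWord n (pro w) := by
  obtain ⟨m, b, h, hk⟩ := exists_hit hn hw
  have hw' := (kw_iff n w).1 hw
  rw [kw_iff]
  refine ⟨pro_length hn hw, fun c hc => ⟨pro_kht_last hn hw h c hc, fun i hi => ?_⟩⟩
  rcases Nat.lt_or_ge i (3*n) with h1 | h1
  · rw [pro_kht hn hw h c hc i h1]
    split_ifs with h2 h3
    · have := h.pos c hc (i+1) (by omega) h2
      omega
    · have := (hw'.2 c hc).2 (i+1) h1
      omega
    · have := (hw'.2 c hc).2 (i+1) h1
      omega
  · rw [show i = 3*n by omega, pro_kht_last hn hw h c hc]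

theorem tripB_shift {F G F' G' : ℕ → ℤ} {N p e : ℕ} (hp : 1 ≤ p)
    (hF : ∀ i, F (i+1) = F' i) (hG : ∀ i, G (i+1) = G' i) (h : TripB F G 1 (N+1) p e) :
    TripB F' G' 0 N (p-1) (e-1) := by
  obtain ⟨q, rfl⟩ : ∃ q, p = q + 1 := ⟨p-1, by omega⟩
  have pL : ∀ k, TPassL F G 1 (q+1) k → TPassL F' G' 0 q k := by
    rintro k ⟨i, h1, h2, h3, h4⟩
    obtain ⟨i, rfl⟩ : ∃ i', i = i' + 1 := ⟨i-1, by omega⟩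
    rw [hG, hG] at h3
    refine ⟨i, by omega, by omega, h3, fun i' h5 h6 => ?_⟩
    have := h4 (i'+1) (by omega) (by omega)
    rwa [hF, hF] at this
  have pR : ∀ k, TPassR F G (N+1) (q+1) k → TPassR F' G' N q k := by
    rintro k ⟨i, h1, h2, h3, h4⟩
    obtain ⟨i, rfl⟩ : ∃ i', i = i' + 1 := ⟨i-1, by omega⟩
    rw [hF, hF] at h3
    refine ⟨i, by omega, by omega, h3, fun i' h5 h6 => ?_⟩
    have := h4 (i'+1) (by omega) (by omega)
    rwa [hG, hG] at this
  obtain ⟨k, hk, hend⟩ := h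
  refine ⟨k, fun k' hk' => ⟨pL _ (hk k' hk').1, pR _ (hk k' hk').2⟩, ?_⟩
  rcases hend with ⟨h1, h2, h3, h4, h5⟩ | ⟨h0, h1, h2, h3, h4, h5⟩
  · left
    obtain ⟨e, rfl⟩ : ∃ i', e = i' + 1 := ⟨e-1, by omega⟩
    rw [hF, hF] at h3
    refine ⟨by omega, by simpa using h2, by simpa using h3, fun i h6 h7 => ?_, fun i h6 h7 => ?_⟩
    · have := h4 (i+1) (by omega) (by omega)
      rwa [hF, hF] at this
    · have := h5 (i+1) (by omega) (by omega)
      rwa [hG, hG] at this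
  · right
    obtain ⟨e, rfl⟩ : ∃ i', e = i' + 1 := ⟨e-1, by omega⟩
    rw [hG, hG] at h3
    refine ⟨pL _ h0, by simpa using h1, by simpa using h2, by simpa using h3,
      fun i h6 h7 => ?_, fun i h6 h7 => ?_⟩
    · have := h4 (i+1) (by omega) (by omega)
      rwa [hG, hG] at this
    · have := h5 (i+1) (by omega) (by omega)
      rwa [hF, hF] at this

/-- The trip from position `p` of `w` ends at `e` with letter `l` (0-indexed). -/
def Trip (n : ℕ) (w : List KLetter) (p e : ℕ) (l : KLetter) : Prop :=
  e < 3 * n ∧ l ≠ A ∧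
  ((w.getD p A = A ∧ p + 1 ≤ e ∧ kht w l (e+1) ≤ kht w l p ∧
      ∀ c, c ≠ A → ∀ i, p + 1 ≤ i → i ≤ e → kht w c p < kht w c i) ∨
    (w.getD p A = negL l ∧ TripB (kht w (negL l)) (kht w l) 0 (3*n) p e))

theorem trip_end {n : ℕ} {w : List KLetter} {e : ℕ} {l : KLetter} (hn : 1 ≤ n)
    (hw : IsKrewerasWord n w) (h : Trip n w 0 e l) : KHit w e l := by
  obtain ⟨h1, h2, ⟨h3, h4, h5, h6⟩ | ⟨h3, h4⟩⟩ := h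
  · have hl := hw.1
    have hw' := (kw_iff n w).1 hw
    have h7 := (hw'.2 l h2).2 (e+1) h1
    have h8 := h6 l h2 e h4 le_rfl
    rw [kht_zero] at h5 h8
    have h9 := kht_succ w l h2 e (by omega)
    refine ⟨h2, h4, by omega, ?_, by omega, fun c hc i hi1 hi2 => ?_⟩
    · unfold kst at h9
      split_ifs at h9 with h10 h11
      · omega
      · exact h11
      · omega
    · have := h6 c hc i hi1 hi2
      rw [kht_zero] at this
      omega
  · rw [kht_first hn hw] at h3
    exact absurd h3.symm (negL_ne h2)

theorem trip_birth {n : ℕ} {w : List KLetter} {m : ℕ} {b : KLetter} (hn : 1 ≤ n)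
    (hw : IsKrewerasWord n w) (h : KHit w m b) :
    Trip n (pro w) (3*n-1) (m-1) (negL b) := by
  have hl := hw.1
  have hm := h.mlt
  have hm1 := h.m1
  have hw' := (kw_iff n w).1 hw
  have hp := (kw_iff n _).1 (pro_kw hn hw)
  have hnb := negL_ne h.hb
  refine ⟨by omega, hnb, Or.inr ⟨?_, ?_⟩⟩
  · rw [negL_negL]; exact pro_getD_last hn hw h
  · rw [negL_negL]
    refine ⟨0, fun k' hk' => by omega, Or.inl ⟨by omega, by omega, ?_, ?_, ?_⟩⟩
    all_goals rw [show 3*n-1+1 = 3*n by omega]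
    · rw [(hp.2 b h.hb).1, pro_kht hn hw h b h.hb _ (by omega), if_pos (by omega),
        show m - 1 + 1 = m by omega]
      have := kht_at h b h.hb
      rw [h.zero, if_pos rfl] at this
      simp; omega
    · intro i h1 h2
      rw [(hp.2 b h.hb).1, pro_kht hn hw h b h.hb _ (by omega), if_neg (by omega), if_pos rfl]
      have := (hw'.2 b h.hb).2 (i+1) (by omega)
      simp; omega
    · intro i h1 h2
      rw [(hp.2 _ hnb).1]
      have := (hp.2 _ hnb).2 i (by omega)
      simpa using this

/-- Cyclic predecessor. -/
def prevN (N e : ℕ) : ℕ := if e = 0 then N - 1 else e - 1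

theorem trip_step_nonA {n : ℕ} {w : List KLetter} {m p e : ℕ} {b l : KLetter} (hn : 1 ≤ n)
    (hw : IsKrewerasWord n w) (h : KHit w m b) (hp1 : 1 ≤ p) (hp : p < 3 * n) (hpm : p ≠ m)
    (he : e < 3 * n) (hlA : l ≠ A)
    (ht : TripB (kht w (negL l)) (kht w l) 0 (3*n) p e) :
    TripB (kht (pro w) (negL l)) (kht (pro w) l) 0 (3*n) (p-1) (prevN (3*n) e) := by
  have hl := hw.1
  have hm := h.mlt
  have hm1 := h.m1
  have hnl := negL_ne hlA
  have hw' := (kw_iff n w).1 hw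
  have key : TripB (fun i => kht (pro w) (negL l) (i-1)) (fun i => kht (pro w) l (i-1)) 1 (3*n+1) p
      (if e = 0 then 3 * n else e) := by
    have h1 : ∀ c, c ≠ A → ∀ i, 1 ≤ i → i ≤ m → kht (pro w) c (i-1) = kht w c i - 1 := by
      intro c hc i hi1 hi2
      rw [pro_kht hn hw h c hc _ (by omega), if_pos (by omega), show i - 1 + 1 = i by omega]
    have h2 : ∀ c, c ≠ A → ∀ i, m < i → i ≤ 3*n → kht (pro w) c (i-1) =
        kht w c i + if c = b then 1 else 0 := by
      intro c hc i hi1 hi2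
      rw [pro_kht hn hw h c hc _ (by omega), if_neg (by omega), show i - 1 + 1 = i by omega]
    have h3 : kht w b m = 1 := by
      have := kht_at h b h.hb
      rw [h.zero, if_pos rfl] at this
      omega
    have hnlne := negL_ne_self hlA
    rcases eq_or_negL hlA h.hb with hb | hb
    · -- hit on g
      subst hb
      have h2' : ∀ i, m < i → i ≤ 3*n → kht (pro w) (negL b) (i-1) = kht w (negL b) i := by
        intro i hi1 hi2; rw [h2 _ hnl i hi1 hi2, if_neg hnlne, add_zero]
      have h2'' : ∀ i, m < i → i ≤ 3*n → kht (pro w) b (i-1) = kht w b i + 1 := by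
        intro i hi1 hi2; rw [h2 _ hlA i hi1 hi2, if_pos rfl]
      rcases Nat.lt_or_gt_of_ne hpm with hlt | hgt
      · have := trip_case3 (3*n) m p e (kht w (negL b)) (kht w b)
          (fun i => kht (pro w) (negL b) (i-1)) (fun i => kht (pro w) b (i-1)) hm1 (by omega) hp1
          (hw'.2 _ hnl).2 (hw'.2 _ hlA).2 (kht_zero _ _) (h.pos _ hnl) (h.pos _ hlA) h.zero h3
          (hit_one hn hw _ hnl) (h1 _ hnl) (h1 _ hlA) hlt ht
        rw [if_neg this.2]; exact this.1
      · exact trip_case2 (3*n) m p e (kht w (negL b)) (kht w b)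
          (fun i => kht (pro w) (negL b) (i-1)) (fun i => kht (pro w) b (i-1)) hm1 (by omega) hp
          (hw'.2 _ hnl).2 (hw'.2 _ hlA).2 (kht_zero _ _) (hw'.2 _ hnl).1 (h.pos _ hnl)
          (h.pos _ hlA) h.zero h3
          (hit_one hn hw _ hnl) (h1 _ hnl) (h1 _ hlA) h2' h2''
          (pro_kht_last hn hw h _ hnl) (pro_kht_last hn hw h _ hlA) hgt ht
    · -- hit on f
      subst hb
      have h2' : ∀ i, m < i → i ≤ 3*n → kht (pro w) (negL l) (i-1) = kht w (negL l) i + 1 := by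
        intro i hi1 hi2; rw [h2 _ hnl i hi1 hi2, if_pos rfl]
      have h2'' : ∀ i, m < i → i ≤ 3*n → kht (pro w) l (i-1) = kht w l i := by
        intro i hi1 hi2; rw [h2 _ hlA i hi1 hi2, if_neg hnlne.symm, add_zero]
      rcases Nat.lt_or_gt_of_ne hpm with hlt | hgt
      · have := trip_case4 (3*n) m p e (kht w (negL l)) (kht w l)
          (fun i => kht (pro w) (negL l) (i-1)) (fun i => kht (pro w) l (i-1)) hm1 (by omega) hp1
          (hw'.2 _ hnl).2 (kht_zero _ _) (kht_zero _ _) (h.pos _ hnl) (h.pos _ hlA) h.zero h3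
          (hit_one hn hw _ hnl) (h1 _ hnl) (h1 _ hlA) h2' h2'' hlt ht
        rw [if_neg this.2]; exact this.1
      · have := trip_case1 (3*n) m p e (kht w (negL l)) (kht w l)
          (fun i => kht (pro w) (negL l) (i-1)) (fun i => kht (pro w) l (i-1)) hm1 (by omega) hp
          (hw'.2 _ hnl).2 h.zero h2' h2'' hgt ht
        rw [if_neg this.2]; exact this.1
  have := tripB_shift (F' := kht (pro w) (negL l)) (G' := kht (pro w) l) hp1
    (fun i => by simp) (fun i => by simp) key
  have he2 : (if e = 0 then 3 * n else e) - 1 = prevN (3*n) e := by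
    unfold prevN; split_ifs <;> rfl
  rwa [he2] at this

theorem trip_step_A {n : ℕ} {w : List KLetter} {m p e : ℕ} {b l : KLetter} (hn : 1 ≤ n)
    (hw : IsKrewerasWord n w) (h : KHit w m b) (hp1 : 1 ≤ p) (hpm : p ≠ m)
    (he : e < 3 * n) (hlA : l ≠ A) (hpe : p + 1 ≤ e)
    (h1 : kht w l (e+1) ≤ kht w l p)
    (h2 : ∀ c, c ≠ A → ∀ i, p + 1 ≤ i → i ≤ e → kht w c p < kht w c i) :
    kht (pro w) l (e-1+1) ≤ kht (pro w) l (p-1) ∧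
    ∀ c, c ≠ A → ∀ i, p-1+1 ≤ i → i ≤ e-1 → kht (pro w) c (p-1) < kht (pro w) c i := by
  have hw' := (kw_iff n w).1 hw
  have hl := hw.1
  have hm := h.mlt
  rcases Nat.lt_or_gt_of_ne hpm with hlt | hgt
  · have hem : e < m := by
      by_contra hc
      rcases Nat.eq_or_lt_of_not_lt hc with h3 | h3
      · subst h3
        have h4 := kht_at h l hlA
        have h5 := h2 l hlA e hpe le_rfl
        have h6 := h.pos l hlA p hp1 (by omega)
        by_cases hlb : l = b
        · subst hlb
          rw [h.zero, if_pos rfl] at h4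
          omega
        · rw [if_neg hlb] at h4
          omega
      · have h4 := h2 b h.hb (m+1) (by omega) (by omega)
        have h6 := h.pos b h.hb p hp1 (by omega)
        rw [h.zero] at h4
        omega
    have hk : ∀ c, c ≠ A → ∀ i, i + 1 ≤ m → kht (pro w) c i = kht w c (i+1) - 1 := by
      intro c hc i hi
      rw [pro_kht hn hw h c hc i (by omega), if_pos hi]
    constructor
    · rw [hk l hlA _ (by omega), hk l hlA _ (by omega), show e - 1 + 1 + 1 = e + 1 by omega,
        show p - 1 + 1 = p by omega]
      omega
    · intro c hc i h3 h4
      have := h2 c hc (i+1) (by omega) (by omega)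
      rw [hk c hc _ (by omega), hk c hc _ (by omega), show p - 1 + 1 = p by omega]
      omega
  · have hk : ∀ c, c ≠ A → ∀ i, m ≤ i → i + 1 ≤ 3 * n → kht (pro w) c i =
        kht w c (i+1) + if c = b then 1 else 0 := by
      intro c hc i hi hi2
      rw [pro_kht hn hw h c hc i (by omega), if_neg (by omega)]
    constructor
    · rw [hk l hlA _ (by omega) (by omega), hk l hlA _ (by omega) (by omega),
        show e - 1 + 1 + 1 = e + 1 by omega, show p - 1 + 1 = p by omega]
      omega
    · intro c hc i h3 h4
      have := h2 c hc (i+1) (by omega) (by omega)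
      rw [hk c hc _ (by omega) (by omega), hk c hc _ (by omega) (by omega),
        show p - 1 + 1 = p by omega]
      omega

theorem trip_step_hit {n : ℕ} {w : List KLetter} {m e : ℕ} {l : KLetter} (hn : 1 ≤ n)
    (hw : IsKrewerasWord n w) (hlA : l ≠ A) (h : KHit w m (negL l))
    (he : e < 3 * n)
    (ht : TripB (kht w (negL l)) (kht w l) 0 (3*n) m e) :
    m + 1 ≤ e ∧
    kht (pro w) l (e-1+1) ≤ kht (pro w) l (m-1) ∧
    ∀ c, c ≠ A → ∀ i, m-1+1 ≤ i → i ≤ e-1 → kht (pro w) c (m-1) < kht (pro w) c i := by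
  have hw' := (kw_iff n w).1 hw
  have hl := hw.1
  have hm := h.mlt
  have hm1 := h.m1
  have hnl := negL_ne hlA
  have hz := h.zero
  have hne := negL_ne_self hlA
  have hgm := kht_at h l hlA
  rw [if_neg hne.symm] at hgm
  have hg1 := h.pos l hlA m hm1 le_rfl
  have hfm := kht_at h _ hnl
  rw [if_pos rfl] at hfm
  obtain ⟨k, hk, hend⟩ := ht
  have hk0 : k = 0 := by
    by_contra hc
    obtain ⟨_, j, hj1, hj2, hj3, _⟩ := hk 0 (by omega)
    have := (hw'.2 _ hnl).2 j hj2
    push_cast at hj3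
    omega
  subst hk0
  rcases hend with ⟨h1, h2, h3, h4, h5⟩ | ⟨h0, h1, h2, h3, h4, h5⟩
  · exfalso
    have he0 : e = 0 := by
      by_contra hc
      have := h.pos _ hnl e (by omega) h2
      push_cast at h3
      omega
    have := h5 0 (by omega) (by omega)
    rw [kht_zero] at this
    push_cast at this
    omega
  · push_cast at h3 h4 h5
    have a1 : ∀ c, c ≠ A → ∀ i, i + 1 ≤ m → kht (pro w) c i = kht w c (i+1) - 1 := by
      intro c hc i hi
      rw [pro_kht hn hw h c hc i (by omega), if_pos hi]
    have a2 : ∀ c, c ≠ A → ∀ i, m ≤ i → i + 1 ≤ 3 * n → kht (pro w) c i =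
        kht w c (i+1) + if c = negL l then 1 else 0 := by
      intro c hc i hi hi2
      rw [pro_kht hn hw h c hc i (by omega), if_neg (by omega)]
    refine ⟨h1, ?_, ?_⟩
    · rw [a2 l hlA _ (by omega) (by omega), a1 l hlA _ (by omega), if_neg hne.symm,
        show e - 1 + 1 + 1 = e + 1 by omega, show m - 1 + 1 = m by omega]
      omega
    · intro c hc i h6 h7
      rw [a2 c hc i (by omega) (by omega), a1 c hc (m-1) (by omega), show m - 1 + 1 = m by omega]
      rcases eq_or_negL hlA hc with rfl | rfl
      · have := h4 (i+1) (by omega) (by omega)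
        rw [if_neg hne.symm]
        omega
      · have := h5 (i+1) (by omega) (by omega)
        rw [if_pos rfl]
        omega

theorem trip_step {n : ℕ} {w : List KLetter} {p e : ℕ} {l : KLetter} (hn : 1 ≤ n)
    (hw : IsKrewerasWord n w) (hp1 : 1 ≤ p) (hp : p < 3 * n) (ht : Trip n w p e l) :
    Trip n (pro w) (p-1) (prevN (3*n) e) l := by
  obtain ⟨m, b, h, -⟩ := exists_hit hn hw
  obtain ⟨he, hlA, ht⟩ := ht
  have hlet := pro_getD hn hw h (p-1) (by omega)
  rw [show p - 1 + 1 = p by omega] at hlet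
  refine ⟨by unfold prevN; split_ifs <;> omega, hlA, ?_⟩
  rcases ht with ⟨h1, h2, h3, h4⟩ | ⟨h1, h2⟩
  · have hpm : p ≠ m := by
      rintro rfl
      rw [h.letter] at h1
      exact h.hb h1
    rw [if_neg hpm] at hlet
    have hpe : prevN (3*n) e = e - 1 := by unfold prevN; rw [if_neg (by omega)]
    rw [hpe]
    exact Or.inl ⟨hlet.trans h1, by omega, trip_step_A hn hw h hp1 hpm he hlA h2 h3 h4⟩
  · by_cases hpm : p = m
    · subst hpm
      rw [if_pos rfl] at hlet
      have hb : b = negL l := by rw [← h.letter, h1]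
      subst hb
      obtain ⟨h3, h4⟩ := trip_step_hit hn hw hlA h he h2
      have hpe : prevN (3*n) e = e - 1 := by unfold prevN; rw [if_neg (by omega)]
      rw [hpe]
      exact Or.inl ⟨hlet, by omega, h4⟩
    · rw [if_neg hpm] at hlet
      exact Or.inr ⟨hlet.trans h1, trip_step_nonA hn hw h hp1 hp hpm he hlA h2⟩

theorem iter_kw {n : ℕ} {w : List KLetter} (hn : 1 ≤ n) (hw : IsKrewerasWord n w) (k : ℕ) :
    IsKrewerasWord n (pro^[k] w) := by
  induction k with
  | zero => exact hw
  | succ k ih => rw [Function.iterate_succ_apply']; exact pro_kw hn ih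

theorem trip_iter {n : ℕ} {w : List KLetter} {m : ℕ} {b : KLetter} (hn : 1 ≤ n)
    (hw : IsKrewerasWord n w) (h : KHit w m b) (k : ℕ) (hk : k ≤ 3 * n - 1) :
    Trip n (pro^[k+1] w) (3*n-1-k) ((prevN (3*n))^[k] (m-1)) (negL b) := by
  induction k with
  | zero => exact trip_birth hn hw h
  | succ k ih =>
    rw [Function.iterate_succ_apply', Function.iterate_succ_apply' (prevN (3*n))]
    have := trip_step hn (iter_kw hn hw (k+1)) (by omega) (by omega) (ih (by omega))
    rwa [show 3 * n - 1 - k - 1 = 3 * n - 1 - (k+1) by omega] at this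

theorem prevN_iter (N e k : ℕ) (he : e < N) (hk : k ≤ N) :
    (prevN N)^[k] e = if k ≤ e then e - k else N + e - k := by
  induction k with
  | zero => simp
  | succ k ih =>
    rw [Function.iterate_succ_apply', ih (by omega)]
    unfold prevN
    split_ifs <;> omega

/-- After `3n` promotions, the hit position is the same and its letter is negated. -/
theorem hit_period {n : ℕ} {w : List KLetter} {m : ℕ} {b : KLetter} (hn : 1 ≤ n)
    (hw : IsKrewerasWord n w) (h : KHit w m b) : KHit (pro^[3*n] w) m (negL b) := by
  have hl := hw.1
  have hm := h.mlt
  have hm1 := h.m1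
  have := trip_iter hn hw h (3*n-1) le_rfl
  rw [prevN_iter _ _ _ (by omega) (by omega), show 3*n-1+1 = 3*n by omega, Nat.sub_self,
    if_neg (by omega), show 3 * n + (m-1) - (3*n-1) = m by omega] at this
  exact trip_end hn (iter_kw hn hw _) this

theorem kht_congr {n : ℕ} {x y : List KLetter} (hx : x.length = 3 * n) (hy : y.length = 3 * n)
    (c : KLetter) (hc : c ≠ A) (j : ℕ) (hj : j ≤ 3 * n)
    (h : ∀ p, p < j → x.getD p A = y.getD p A) : kht x c j = kht y c j := by
  induction j with
  | zero => rw [kht_zero, kht_zero]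
  | succ j ih =>
    rw [kht_succ x c hc j (by omega), kht_succ y c hc j (by omega),
      ih (by omega) (fun p hp => h p (by omega)), h j (by omega)]

theorem getD_ext {n : ℕ} {x y : List KLetter} (hx : x.length = n) (hy : y.length = n)
    (h : ∀ p, p < n → x.getD p A = y.getD p A) : x = y := by
  apply List.ext_getElem (by omega)
  intro p h1 h2
  have := h p (by omega)
  rwa [List.getD_eq_getElem _ _ h1, List.getD_eq_getElem _ _ h2] at this

/-- The swap of the letters `i`, `i+1` (1-indexed). -/
def ksw (i : ℕ) (w : List KLetter) : List KLetter :=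
  (w.set (i - 1) (w.getD i A)).set i (w.getD (i - 1) A)

theorem ksw_length (i : ℕ) (w : List KLetter) : (ksw i w).length = w.length := by
  simp [ksw]

theorem ksw_getD (i : ℕ) (w : List KLetter) (hi : i < w.length) (p : ℕ) :
    (ksw i w).getD p A = if p = i then w.getD (i-1) A else if p = i - 1 then w.getD i A
      else w.getD p A := by
  unfold ksw
  simp only [List.getD_eq_getElem?_getD, List.getElem?_set, List.length_set]
  split_ifs <;> first | omega | rfl

/-- The local condition for the swap to be allowed. -/
def kok (i : ℕ) (w : List KLetter) : Prop :=
  ∀ c, c ≠ A → 0 ≤ kht w c (i-1) + kst c (w.getD i A)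

theorem ksw_kht {n i : ℕ} {w : List KLetter} (hl : w.length = 3 * n) (hi1 : 1 ≤ i)
    (hi : i < 3 * n) (c : KLetter) (hc : c ≠ A) (j : ℕ) (hj : j ≤ 3 * n) :
    kht (ksw i w) c j = if j = i then kht w c (i-1) + kst c (w.getD i A) else kht w c j := by
  have hsl : (ksw i w).length = 3 * n := by rw [ksw_length, hl]
  have hlt : ∀ j, j ≤ i - 1 → kht (ksw i w) c j = kht w c j := by
    intro j hj
    apply kht_congr hsl hl c hc j (by omega)
    intro p hp
    rw [ksw_getD i w (by omega), if_neg (by omega), if_neg (by omega)]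
  have hat : kht (ksw i w) c i = kht w c (i-1) + kst c (w.getD i A) := by
    have h1 := kht_succ (ksw i w) c hc (i-1) (by omega)
    rw [ksw_getD i w (by omega), if_neg (by omega), if_pos rfl, hlt _ le_rfl,
      show i - 1 + 1 = i by omega] at h1
    exact h1
  rcases Nat.lt_trichotomy j i with h | h | h
  · rw [if_neg (by omega), hlt j (by omega)]
  · subst h; rw [if_pos rfl, hat]
  · rw [if_neg (by omega)]
    induction j with
    | zero => omega
    | succ j ih =>
      rw [kht_succ (ksw i w) c hc j (by omega), kht_succ w c hc j (by omega)]
      rcases Nat.eq_or_lt_of_le (Nat.lt_succ_iff.1 h) with h2 | h2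
      · subst h2
        have h1 := kht_succ w c hc (i-1) (by omega)
        rw [show i - 1 + 1 = i by omega] at h1
        rw [hat, h1, ksw_getD i w (by omega), if_pos rfl]
        ring
      · rw [ih (by omega) h2, ksw_getD i w (by omega), if_neg (by omega), if_neg (by omega)]

theorem ksw_kw {n i : ℕ} {w : List KLetter} (hw : IsKrewerasWord n w) (hi1 : 1 ≤ i)
    (hi : i < 3 * n) : IsKrewerasWord n (ksw i w) ↔ kok i w := by
  have hw' := (kw_iff n w).1 hw
  rw [kw_iff]
  constructor
  · rintro ⟨h1, h2⟩ c hc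
    have := (h2 c hc).2 i hi.le
    rwa [ksw_kht hw.1 hi1 hi c hc i hi.le, if_pos rfl] at this
  · intro h
    refine ⟨by rw [ksw_length, hw.1], fun c hc => ⟨?_, fun j hj => ?_⟩⟩
    · rw [ksw_kht hw.1 hi1 hi c hc _ le_rfl, if_neg (by omega)]
      exact (hw'.2 c hc).1
    · rw [ksw_kht hw.1 hi1 hi c hc _ hj]
      split_ifs
      · exact h c hc
      · exact (hw'.2 c hc).2 j hj

theorem ksw_ksw {i : ℕ} {w : List KLetter} (hi1 : 1 ≤ i) (hi : i < w.length) :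
    ksw i (ksw i w) = w := by
  apply getD_ext (n := w.length) (by simp [ksw_length]) rfl
  intro p hp
  rw [ksw_getD i _ (by rw [ksw_length]; omega), ksw_getD i w hi, ksw_getD i w hi, ksw_getD i w hi]
  split_ifs <;> first | omega | simp_all

theorem tau_eq (n i : ℕ) (w : List KLetter) :
    tau n i w = open Classical in if IsKrewerasWord n (ksw i w) then ksw i w else w := rfl

theorem tau_ok {n i : ℕ} {w : List KLetter} (hw : IsKrewerasWord n w) (hi1 : 1 ≤ i)
    (hi : i < 3 * n) (h : kok i w) : tau n i w = ksw i w := by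
  rw [tau_eq, if_pos ((ksw_kw hw hi1 hi).2 h)]

theorem tau_nok {n i : ℕ} {w : List KLetter} (hw : IsKrewerasWord n w) (hi1 : 1 ≤ i)
    (hi : i < 3 * n) (h : ¬ kok i w) : tau n i w = w := by
  rw [tau_eq, if_neg (fun h1 => h ((ksw_kw hw hi1 hi).1 h1))]

theorem tau_kw {n i : ℕ} {w : List KLetter} (hw : IsKrewerasWord n w) :
    IsKrewerasWord n (tau n i w) := by
  rw [tau_eq]
  split_ifs with h
  · exact h
  · exact hw

theorem tau_tau {n i : ℕ} {w : List KLetter} (hw : IsKrewerasWord n w) (hi1 : 1 ≤ i)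
    (hi : i < 3 * n) : tau n i (tau n i w) = w := by
  by_cases h : kok i w
  · have h1 := (ksw_kw hw hi1 hi).2 h
    have hl := hw.1
    rw [tau_ok hw hi1 hi h, tau_eq, ksw_ksw hi1 (by omega), if_pos hw]
  · rw [tau_nok hw hi1 hi h, tau_nok hw hi1 hi h]

theorem kok_ksw {n i j : ℕ} {w : List KLetter} (hw : IsKrewerasWord n w) (hi1 : 1 ≤ i)
    (hi : i < 3 * n) (hj1 : 1 ≤ j) (hj : j < 3 * n) (hij : i + 2 ≤ j ∨ j + 2 ≤ i) :
    kok i (ksw j w) ↔ kok i w := by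
  have hl := hw.1
  unfold kok
  apply forall_congr'; intro c
  apply forall_congr'; intro hc
  rw [ksw_kht hl hj1 hj c hc _ (by omega), ksw_getD j w (by omega), if_neg (by omega),
    if_neg (by omega), if_neg (by omega)]

theorem ksw_comm {i j : ℕ} {w : List KLetter} (hi1 : 1 ≤ i) (hi : i < w.length)
    (hj1 : 1 ≤ j) (hj : j < w.length) (hij : i + 2 ≤ j) :
    ksw i (ksw j w) = ksw j (ksw i w) := by
  apply getD_ext (n := w.length) (by simp [ksw_length]) (by simp [ksw_length])
  intro p hp
  simp only [ksw_getD i w hi, ksw_getD j w hj, ksw_getD i (ksw j w) (by rw [ksw_length]; omega),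
    ksw_getD j (ksw i w) (by rw [ksw_length]; omega)]
  split_ifs <;> first | omega | rfl

theorem tau_comm {n i j : ℕ} {w : List KLetter} (hw : IsKrewerasWord n w) (hi1 : 1 ≤ i)
    (hi : i < 3 * n) (hj1 : 1 ≤ j) (hj : j < 3 * n) (hij : i + 2 ≤ j) :
    tau n i (tau n j w) = tau n j (tau n i w) := by
  have hl := hw.1
  have ei := kok_ksw hw hi1 hi hj1 hj (Or.inl hij)
  have ej := kok_ksw hw hj1 hj hi1 hi (Or.inr hij)
  by_cases h1 : kok i w <;> by_cases h2 : kok j w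
  · rw [tau_ok hw hj1 hj h2, tau_ok hw hi1 hi h1,
      tau_ok ((ksw_kw hw hj1 hj).2 h2) hi1 hi (ei.2 h1),
      tau_ok ((ksw_kw hw hi1 hi).2 h1) hj1 hj (ej.2 h2),
      ksw_comm hi1 (by omega) hj1 (by omega) hij]
  · rw [tau_nok hw hj1 hj h2, tau_ok hw hi1 hi h1,
      tau_nok ((ksw_kw hw hi1 hi).2 h1) hj1 hj (fun h => h2 (ej.1 h))]
  · rw [tau_ok hw hj1 hj h2, tau_nok hw hi1 hi h1, tau_ok hw hj1 hj h2,
      tau_nok ((ksw_kw hw hj1 hj).2 h2) hi1 hi (fun h => h1 (ei.1 h))]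
  · rw [tau_nok hw hj1 hj h2, tau_nok hw hi1 hi h1, tau_nok hw hj1 hj h2]

theorem tauDown_kw {n : ℕ} (j : ℕ) {w : List KLetter} (hw : IsKrewerasWord n w) :
    IsKrewerasWord n (tauDown n j w) := by
  induction j with
  | zero => exact hw
  | succ j ih => exact tau_kw ih

theorem tauDown_getD {n : ℕ} {x : List KLetter} {m : ℕ} {b : KLetter} (hn : 1 ≤ n)
    (hx : IsKrewerasWord n x) (h : KHit x m b) (j : ℕ) (hj : j ≤ 3 * n - 1) (p : ℕ) :
    (tauDown n j x).getD p A =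
      if p < j then (if p + 1 = m then A else x.getD (p+1) A)
      else if p = j then (if m ≤ j then b else A) else x.getD p A := by
  have hl := hx.1
  have hm1 := h.m1
  have hx' := (kw_iff n x).1 hx
  induction j generalizing p with
  | zero =>
    rw [if_neg (by omega)]
    by_cases hp : p = 0
    · subst hp
      rw [if_pos rfl, if_neg (by omega)]
      exact kht_first hn hx
    · rw [if_neg hp]; rfl
  | succ j ih =>
    have ih := ih (by omega)
    have hy := tauDown_kw j hx
    change (tau n (j+1) (tauDown n j x)).getD p A = _
    generalize tauDown n j x = y at ih hy
    have hyl := hy.1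
    have hk := fun c hc => kht_slide hn hx h c hc j (by omega) hyl (fun i hi => by
      rw [ih i, if_pos hi])
    have hyj1 : y.getD (j+1) A = x.getD (j+1) A := by
      rw [ih, if_neg (by omega), if_neg (by omega)]
    have hyj : y.getD j A = if m ≤ j then b else A := by
      rw [ih, if_neg (by omega), if_pos rfl]
    by_cases hjm : j + 1 = m
    · have hno : ¬ kok (j+1) y := by
        intro hc
        have := hc b h.hb
        rw [hyj1, Nat.add_sub_cancel, hk b h.hb, if_pos hjm.le] at this
        have h2 := kht_succ x b h.hb (j+1) (by omega)
        have h3 := h.zero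
        rw [← hjm] at h3
        omega
      rw [tau_nok hy (by omega) (by omega) hno]
      rcases Nat.lt_trichotomy p j with hp | hp | hp
      · rw [ih, if_pos hp, if_pos (show p < j + 1 by omega)]
      · subst hp
        rw [hyj, if_neg (by omega), if_pos (by omega), if_pos hjm]
      · rw [ih, if_neg (by omega), if_neg (by omega), if_neg (by omega)]
        by_cases hp2 : p = j + 1
        · rw [if_pos hp2, if_pos (by omega), hp2, hjm, h.letter]
        · rw [if_neg hp2]
    · have hyes : kok (j+1) y := by
        intro c hc
        have h2 := kht_succ x c hc (j+1) (by omega)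
        have h3 := (hx'.2 c hc).2 (j+1+1) (by omega)
        rw [hyj1, Nat.add_sub_cancel, hk c hc]
        split_ifs with h4 h5
        · have := h.pos c hc (j+1+1) (by omega) (by omega)
          omega
        · omega
        · omega
      rw [tau_ok hy (by omega) (by omega) hyes, ksw_getD (j+1) y (by omega), Nat.add_sub_cancel,
        hyj, hyj1, ih]
      split_ifs <;> first | omega | rfl | simp_all

theorem tauDown_pro {n : ℕ} {x : List KLetter} (hn : 1 ≤ n)
    (hx : IsKrewerasWord n x) : tauDown n (3*n-1) x = pro x := by
  obtain ⟨m, b, h, -⟩ := exists_hit hn hx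
  have hl := hx.1
  have hm := h.mlt
  apply getD_ext (n := 3*n) (tauDown_kw _ hx).1 (pro_length hn hx)
  intro p hp
  rw [tauDown_getD hn hx h _ le_rfl]
  by_cases hp2 : p < 3*n-1
  · rw [if_pos hp2, pro_getD hn hx h p hp2]
  · rw [if_neg hp2, if_pos (by omega), if_pos (by omega), show p = 3*n-1 by omega,
      pro_getD_last hn hx h]

theorem hit_congr {n : ℕ} {x y : List KLetter} {m J : ℕ} {b : KLetter}
    (hx : x.length = 3 * n) (hy : y.length = 3 * n) (h : KHit x m b) (hm : m ≤ J)
    (hxy : ∀ p, p ≤ J → x.getD p A = y.getD p A) : KHit y m b := by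
  have hml := h.mlt
  refine ⟨h.hb, h.m1, by omega, ?_, ?_, ?_⟩
  · rw [← hxy m hm, h.letter]
  · rw [← kht_congr hx hy b h.hb (m+1) (by omega) (fun p hp => hxy p (by omega)), h.zero]
  · intro c hc i hi1 hi2
    rw [← kht_congr hx hy c hc i (by omega) (fun p hp => hxy p (by omega))]
    exact h.pos c hc i hi1 hi2

/-- 0-indexed hit position. -/
def kM (w : List KLetter) : ℕ := kiota w - 1
/-- hit letter. -/
def kL (w : List KLetter) : KLetter := w.getD (kiota w - 1) A

theorem kML_of {n : ℕ} {w : List KLetter} {m : ℕ} {b : KLetter} (hn : 1 ≤ n)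
    (hw : IsKrewerasWord n w) (h : KHit w m b) : kM w = m ∧ kL w = b := by
  unfold kM kL
  rw [h.iota hn hw]
  exact ⟨rfl, h.letter⟩

theorem hit_ML {n : ℕ} {w : List KLetter} (hn : 1 ≤ n)
    (hw : IsKrewerasWord n w) : KHit w (kM w) (kL w) := by
  obtain ⟨m, b, h, -⟩ := exists_hit hn hw
  obtain ⟨h1, h2⟩ := kML_of hn hw h
  rw [h1, h2]; exact h

theorem evacAux_getD {n : ℕ} (hn : 1 ≤ n) (j : ℕ) (hj : j ≤ 3 * n - 1) (x v : List KLetter)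
    (hx : IsKrewerasWord n x) (hv : IsKrewerasWord n v)
    (hxv : ∀ p, p ≤ j → x.getD p A = v.getD p A) (p : ℕ) :
    (evacAux n j x).getD p A = if p ≤ j then
      (if kM (pro^[j-p] v) + (j-p) ≤ j then kL (pro^[j-p] v) else A) else x.getD p A := by
  induction j generalizing x v p with
  | zero =>
    change x.getD p A = _
    split_ifs with h1 h2
    · have := (hit_ML hn (iter_kw hn hv (0-p))).m1
      omega
    · rw [show p = 0 by omega]; exact kht_first hn hx
    · rfl
  | succ j ih =>
    change (evacAux n j (tauDown n (j+1) x)).getD p A = _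
    have hX := hit_ML hn hx
    have hV := hit_ML hn hv
    have hxl := hx.1
    have hvl := hv.1
    have e1 : kM x ≤ j + 1 → kM x = kM v ∧ kL x = kL v := fun h =>
      (hit_congr hxl hvl hX h hxv).unique hV
    have e2 : kM v ≤ j + 1 → kM x = kM v ∧ kL x = kL v := fun h =>
      hX.unique (hit_congr hvl hxl hV h (fun p hp => (hxv p hp).symm))
    have hx' := tauDown_kw (j+1) hx
    have hag : ∀ p, p ≤ j → (tauDown n (j+1) x).getD p A = (pro v).getD p A := by
      intro p hp
      rw [tauDown_getD hn hx hX _ hj, if_pos (by omega), pro_getD hn hv hV p (by omega),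
        hxv (p+1) (by omega)]
      by_cases h1 : p + 1 = kM x
      · rw [if_pos h1, if_pos (by rw [h1]; exact (e1 (by omega)).1)]
      · rw [if_neg h1, if_neg]
        intro h2
        exact h1 (h2.trans (e2 (by omega)).1.symm)
    rw [ih (by omega) _ _ hx' (pro_kw hn hv) hag]
    by_cases hp : p ≤ j
    · rw [if_pos hp, if_pos (show p ≤ j + 1 by omega), ← Function.iterate_succ_apply,
        show (j - p).succ = j + 1 - p by omega]
      by_cases h1 : kM (pro^[j + 1 - p] v) + (j - p) ≤ j
      · rw [if_pos h1, if_pos (by omega)]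
      · rw [if_neg h1, if_neg (by omega)]
    · rw [if_neg hp, tauDown_getD hn hx hX _ hj]
      by_cases hp2 : p = j + 1
      · subst hp2
        rw [if_neg (by omega), if_pos rfl, if_pos le_rfl, Nat.sub_self]
        simp only [Function.iterate_zero, id_eq, add_zero]
        by_cases h1 : kM x ≤ j + 1
        · rw [if_pos h1, if_pos (by rw [← (e1 h1).1]; exact h1), (e1 h1).2]
        · rw [if_neg h1, if_neg]
          intro h2
          exact h1 (by rw [(e2 h2).1]; exact h2)
      · rw [if_neg (by omega), if_neg hp2, if_neg (by omega)]

section GroupIdentities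

variable {G : Type*} [Group G]

/-- `D_k = t_k ... t_1`. -/
def gD (t : ℕ → G) : ℕ → G
  | 0 => 1
  | k + 1 => t (k + 1) * gD t k

/-- `E_k = D_1 ... D_k`. -/
def gE (t : ℕ → G) : ℕ → G
  | 0 => 1
  | k + 1 => gE t k * gD t (k + 1)

/-- `A_{k,c} = t_{k+c-1} ... t_k`. -/
def gA (t : ℕ → G) (k : ℕ) : ℕ → G
  | 0 => 1
  | j + 1 => t (k + j) * gA t k j

/-- `S_j = A_1 ... A_j`. -/
def gS (t : ℕ → G) (N : ℕ) : ℕ → G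
  | 0 => 1
  | j + 1 => gS t N j * gA t (j + 1) (N - (j + 1))

theorem gD_comm (t : ℕ → G) (g : G) (k : ℕ) (h : ∀ i, i ≤ k → Commute g (t i)) :
    Commute g (gD t k) := by
  induction k with
  | zero => exact Commute.one_right g
  | succ k ih => exact (h (k+1) le_rfl).mul_right (ih fun i hi => h i (by omega))

theorem gE_comm (t : ℕ → G) (g : G) (k : ℕ) (h : ∀ i, i ≤ k → Commute g (t i)) :
    Commute g (gE t k) := by
  induction k with
  | zero => exact Commute.one_right g
  | succ k ih => exact (ih fun i hi => h i (by omega)).mul_right (gD_comm t g (k+1) h)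

theorem gA_comm (t : ℕ → G) (g : G) (k j : ℕ) (h : ∀ i, k ≤ i → Commute g (t i)) :
    Commute g (gA t k j) := by
  induction j with
  | zero => exact Commute.one_right g
  | succ j ih => exact (h (k+j) (by omega)).mul_right ih

theorem gDED (t : ℕ → G) (h1 : ∀ i, t i * t i = 1)
    (h2 : ∀ i j, i + 2 ≤ j → Commute (t j) (t i)) (k : ℕ) :
    gD t (k+1) * gE t k * gD t (k+1) = gE t k := by
  induction k with
  | zero => simp [gD, gE, h1]
  | succ k ih =>
    have hc : Commute (t (k+2)) (gE t k) := gE_comm t _ k fun i hi => h2 i (k+2) (by omega)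
    have e1 : gD t (k+1+1) = t (k+2) * gD t (k+1) := rfl
    have e2 : gE t (k+1) = gE t k * gD t (k+1) := rfl
    calc gD t (k+1+1) * gE t (k+1) * gD t (k+1+1)
        = t (k+2) * (gD t (k+1) * gE t k * gD t (k+1)) * t (k+2) * gD t (k+1) := by
          rw [e1, e2]; simp only [mul_assoc]
      _ = (t (k+2) * gE t k) * t (k+2) * gD t (k+1) := by rw [ih]
      _ = gE t k * (t (k+2) * t (k+2)) * gD t (k+1) := by rw [hc.eq]; simp only [mul_assoc]
      _ = gE t (k+1) := by rw [h1, mul_one, e2]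

theorem gA_gD (t : ℕ → G) (j c : ℕ) : gA t (j+1) c * gD t j = gD t (j + c) := by
  induction c with
  | zero => simp [gA]
  | succ c ih =>
    change t (j+1+c) * gA t (j+1) c * gD t j = gD t (j+c+1)
    rw [mul_assoc, ih, show j + 1 + c = j + c + 1 by omega]
    rfl

theorem gS_eq (t : ℕ → G) (h1 : ∀ i, t i * t i = 1)
    (h2 : ∀ i j, i + 2 ≤ j → Commute (t j) (t i)) (N j : ℕ) (hj : j + 2 ≤ N) :
    gS t N (j+1) = gD t (N-1) ^ (j+1) * gE t j := by
  induction j with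
  | zero =>
    have := gA_gD t 0 (N-1)
    simp only [gD, mul_one, zero_add] at this
    simp [gS, gE, this]
  | succ j ih =>
    have hc : Commute (gE t j) (gA t (j+2) (N - (j+2))) := by
      apply gA_comm
      intro i hi
      exact (gE_comm t (t i) j fun i' hi' => h2 i' i (by omega)).symm
    have e1 : gS t N (j+1+1) = gS t N (j+1) * gA t (j+2) (N - (j+2)) := rfl
    have e2 : gA t (j+2) (N-(j+2)) * gD t (j+1) = gD t (N-1) := by
      rw [gA_gD, show j + 1 + (N-(j+2)) = N - 1 by omega]
    have e3 : gA t (j+2) (N-(j+2)) * gE t j = gD t (N-1) * gE t (j+1) := by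
      have := gDED t h1 h2 j
      calc gA t (j+2) (N-(j+2)) * gE t j
          = gA t (j+2) (N-(j+2)) * (gD t (j+1) * gE t j * gD t (j+1)) := by rw [this]
        _ = gA t (j+2) (N-(j+2)) * gD t (j+1) * (gE t j * gD t (j+1)) := by
            simp only [mul_assoc]
        _ = _ := by rw [e2]; rfl
    rw [e1, ih (by omega), mul_assoc, hc.eq, e3, pow_succ _ (j+1), mul_assoc]

theorem g_final (t : ℕ → G) (h1 : ∀ i, t i * t i = 1)
    (h2 : ∀ i j, i + 2 ≤ j → Commute (t j) (t i)) (N : ℕ) (hN : 2 ≤ N) :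
    gD t (N-1) * gE t (N-1) * gD t (N-1) = gE t (N-1) ∧
    gS t N (N-1) = gD t (N-1) ^ N * gE t (N-1) := by
  obtain ⟨j, rfl⟩ : ∃ j, N = j + 2 := ⟨N-2, by omega⟩
  have e := gDED t h1 h2 j
  have eE : gE t (j+1) = gE t j * gD t (j+1) := rfl
  have hs := gS_eq t h1 h2 (j+2) j le_rfl
  simp only [show j + 2 - 1 = j + 1 by omega] at hs ⊢
  constructor
  · rw [eE, ← mul_assoc, e]
  · rw [hs, pow_succ _ (j+1), mul_assoc, eE, ← mul_assoc (gD t (j+1)), e]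

end GroupIdentities

/-- The type of Kreweras words. -/
abbrev KW (n : ℕ) := {w : List KLetter // IsKrewerasWord n w}

/-- Toggles as permutations. -/
noncomputable def tP (n i : ℕ) : Equiv.Perm (KW n) :=
  if h : 1 ≤ i ∧ i < 3 * n then
    Function.Involutive.toPerm (fun w => ⟨tau n i w.1, tau_kw w.2⟩)
      (fun w => Subtype.ext (tau_tau w.2 h.1 h.2))
  else 1

theorem tP_apply {n i : ℕ} (h1 : 1 ≤ i) (h2 : i < 3 * n) (w : KW n) :
    (tP n i w).1 = tau n i w.1 := by
  unfold tP
  rw [dif_pos ⟨h1, h2⟩]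
  rfl

theorem tP_sq (n i : ℕ) : tP n i * tP n i = 1 := by
  by_cases h : 1 ≤ i ∧ i < 3 * n
  · ext w : 2
    simp only [Equiv.Perm.mul_apply, Equiv.Perm.one_apply]
    rw [tP_apply h.1 h.2, tP_apply h.1 h.2, tau_tau w.2 h.1 h.2]
  · unfold tP
    rw [dif_neg h, one_mul]

theorem tP_comm (n i j : ℕ) (hij : i + 2 ≤ j) : Commute (tP n j) (tP n i) := by
  by_cases hi : 1 ≤ i ∧ i < 3 * n
  · by_cases hj : 1 ≤ j ∧ j < 3 * n
    · ext w : 2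
      simp only [Equiv.Perm.mul_apply]
      rw [tP_apply hj.1 hj.2, tP_apply hi.1 hi.2, tP_apply hi.1 hi.2, tP_apply hj.1 hj.2,
        tau_comm w.2 hi.1 hi.2 hj.1 hj.2 hij]
    · have : tP n j = 1 := by unfold tP; rw [dif_neg hj]
      rw [this]; exact Commute.one_left _
  · have : tP n i = 1 := by unfold tP; rw [dif_neg hi]
    rw [this]; exact Commute.one_right _

theorem gD_apply {n j : ℕ} (hj : j < 3 * n) (w : KW n) :
    (gD (tP n) j w).1 = tauDown n j w.1 := by
  induction j with
  | zero => rfl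
  | succ j ih =>
    change (tP n (j+1) (gD (tP n) j w)).1 = tau n (j+1) (tauDown n j w.1)
    rw [tP_apply (by omega) hj, ih (by omega)]

theorem gE_apply {n j : ℕ} (hj : j < 3 * n) (w : KW n) :
    (gE (tP n) j w).1 = evacAux n j w.1 := by
  induction j generalizing w with
  | zero => rfl
  | succ j ih =>
    change (gE (tP n) j (gD (tP n) (j+1) w)).1 = evacAux n j (tauDown n (j+1) w.1)
    rw [ih (by omega), gD_apply hj]

theorem gA_apply {n k j : ℕ} (hk : 1 ≤ k) (hj : k + j ≤ 3 * n) (w : KW n) :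
    (gA (tP n) k j w).1 = tauAsc n k j w.1 := by
  induction j with
  | zero => rfl
  | succ j ih =>
    change (tP n (k+j) (gA (tP n) k j w)).1 = tau n (k+j) (tauAsc n k j w.1)
    rw [tP_apply (by omega) (by omega), ih (by omega)]

theorem gS_apply {n j : ℕ} (hj : j < 3 * n) (w : KW n) :
    (gS (tP n) (3*n) j w).1 = evacStarAux n j w.1 := by
  induction j generalizing w with
  | zero => rfl
  | succ j ih =>
    change (gS (tP n) (3*n) j (gA (tP n) (j+1) (3*n-(j+1)) w)).1 =
      evacStarAux n j (tauAsc n (j+1) (3*n-(j+1)) w.1)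
    rw [ih (by omega), gA_apply (by omega) (by omega)]

/-- Promotion as a permutation. -/
noncomputable def kP (n : ℕ) : Equiv.Perm (KW n) := gD (tP n) (3*n-1)
/-- Evacuation as a permutation. -/
noncomputable def kE (n : ℕ) : Equiv.Perm (KW n) := gE (tP n) (3*n-1)

theorem kP_apply {n : ℕ} (hn : 1 ≤ n) (w : KW n) : (kP n w).1 = pro w.1 := by
  unfold kP
  rw [gD_apply (by omega), tauDown_pro hn w.2]

theorem kP_pow_apply {n : ℕ} (hn : 1 ≤ n) (w : KW n) (k : ℕ) :
    ((kP n ^ k) w).1 = pro^[k] w.1 := by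
  induction k with
  | zero => rfl
  | succ k ih =>
    rw [pow_succ', Equiv.Perm.mul_apply, kP_apply hn, ih, Function.iterate_succ_apply']

theorem kPEP {n : ℕ} (hn : 1 ≤ n) : kP n * kE n * kP n = kE n :=
  (g_final (tP n) (tP_sq n) (tP_comm n) (3*n) (by omega)).1

theorem evacStar_apply {n : ℕ} (hn : 1 ≤ n) (w : KW n) :
    evacStar n w.1 = ((kP n ^ (3*n) * kE n) w).1 := by
  unfold evacStar kP kE
  rw [← gS_apply (by omega), (g_final (tP n) (tP_sq n) (tP_comm n) (3*n) (by omega)).2]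

theorem kE_getD {n : ℕ} (hn : 1 ≤ n) (x : KW n) (p : ℕ) (hp : p ≤ 3 * n - 1) :
    (kE n x).1.getD p A =
      if kM ((kP n ^ (3*n-1-p)) x).1 + (3*n-1-p) ≤ 3 * n - 1
      then kL ((kP n ^ (3*n-1-p)) x).1 else A := by
  unfold kE
  rw [gE_apply (by omega), evacAux_getD hn _ le_rfl x.1 x.1 x.2 x.2 (fun _ _ => rfl), if_pos hp,
    kP_pow_apply hn]

theorem kM_period {n : ℕ} (hn : 1 ≤ n) (x : KW n) :
    kM ((kP n ^ (3*n)) x).1 = kM x.1 ∧ kL ((kP n ^ (3*n)) x).1 = negL (kL x.1) := by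
  rw [kP_pow_apply hn]
  exact kML_of hn (iter_kw hn x.2 _) (hit_period hn x.2 (hit_ML hn x.2))

theorem kM_zpow {n : ℕ} (hn : 1 ≤ n) (x : KW n) (a b q : ℤ) (h : a = b + q * (3 * n : ℕ)) :
    kM ((kP n ^ a) x).1 = kM ((kP n ^ b) x).1 := by
  have hper : Function.Periodic (fun a : ℤ => kM ((kP n ^ a) x).1) ((3 * n : ℕ) : ℤ) := by
    intro a
    simp only
    rw [add_comm a, zpow_add, zpow_natCast, Equiv.Perm.mul_apply, (kM_period hn _).1]
  subst h
  exact hper.int_mul q b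

theorem kE_pow {n : ℕ} (hn : 1 ≤ n) (k : ℕ) : kP n ^ k * kE n = kE n * kP n ^ (-(k:ℤ)) := by
  induction k with
  | zero => simp
  | succ k ih =>
    have e1 : kP n * kE n = kE n * (kP n)⁻¹ := by
      rw [eq_mul_inv_iff_mul_eq]; exact kPEP hn
    rw [pow_succ', mul_assoc, ih, ← mul_assoc, e1, mul_assoc, ← zpow_neg_one, ← zpow_add]
    congr 2
    push_cast; ring

theorem main_star {n : ℕ} (hn : 1 ≤ n) (w : KW n) (i : ℕ) :
    kM (pro^[i] (evacStar n w.1)) = kM (kE n ((kP n ^ (-(i:ℤ))) w)).1 ∧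
    kL (pro^[i] (evacStar n w.1)) = negL (kL (kE n ((kP n ^ (-(i:ℤ))) w)).1) := by
  have h : pro^[i] (evacStar n w.1) =
      ((kP n ^ (3*n)) (kE n ((kP n ^ (-(i:ℤ))) w))).1 := by
    rw [evacStar_apply hn, ← kP_pow_apply hn, ← Equiv.Perm.mul_apply, ← Equiv.Perm.mul_apply,
      ← Equiv.Perm.mul_apply, mul_assoc _ (kE n), ← kE_pow hn, ← mul_assoc, ← mul_assoc,
      ← pow_add, ← pow_add, Nat.add_comm]
  rw [h]
  exact kM_period hn _

/-- `P (E (P^{-i} w)) = E (P^{-i-1} w)`. -/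
theorem PE_step {n : ℕ} (hn : 1 ≤ n) (w : KW n) (i : ℕ) :
    kP n (kE n ((kP n ^ (-(i:ℤ))) w)) = kE n ((kP n ^ (-((i+1 : ℕ):ℤ))) w) := by
  rw [← Equiv.Perm.mul_apply, ← Equiv.Perm.mul_apply, ← Equiv.Perm.mul_apply, mul_assoc,
    ← kE_pow hn, ← kE_pow hn, ← mul_assoc, ← pow_succ']

theorem main_sigma {n : ℕ} (hn : 1 ≤ n) (w : KW n) (i j : ℕ) (hi : i < 3 * n) (hj : j < 3 * n)
    (h : (kM (pro^[j] w.1) + j) % (3 * n) = 3 * n - 1 - i) :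
    kM (pro^[i] (evacStar n w.1)) = kM (pro^[j] w.1) := by
  rw [(main_star hn w i).1]
  have hH := hit_ML hn (iter_kw hn w.2 j)
  have hHl := hH.mlt
  have hH1 := hH.m1
  rw [(iter_kw hn w.2 j).1] at hHl
  set c := kM (pro^[j] w.1) with hc
  have hq : ∃ q : ℤ, (3*n:ℕ) - (c:ℤ) - i - 1 = j + q * (3*n:ℕ) := by
    have := Nat.div_add_mod (c+j) (3*n)
    rw [h] at this
    refine ⟨-(((c+j)/(3*n) : ℕ) : ℤ), ?_⟩
    generalize (c+j)/(3*n) = d at this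
    have h2 : ((3*n*d + (3*n-1-i) : ℕ) : ℤ) = ((c + j : ℕ) : ℤ) := by rw [this]
    rw [show 3*n-1-i = 3*n - (1+i) by omega] at h2
    push_cast [Nat.cast_sub (show 1 + i ≤ 3 * n by omega)] at h2
    push_cast
    linarith
  obtain ⟨q, hq⟩ := hq
  have hM : kM ((kP n ^ ((3*n:ℕ) - (c:ℤ) - i - 1)) w).1 = c := by
    rw [kM_zpow hn w _ _ q hq, zpow_natCast, kP_pow_apply hn]
  set z := (kP n ^ (-(i:ℤ))) w with hz
  set z' := (kP n ^ (-((i+1:ℕ):ℤ))) w with hz'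
  have hzz : (kP n ^ (3*n-1-c)) z = (kP n ^ ((3*n:ℕ) - (c:ℤ) - i - 1)) w := by
    rw [hz, ← Equiv.Perm.mul_apply, ← zpow_natCast, ← zpow_add]
    congr 2
    omega
  have hzz' : (kP n ^ (3*n-1-(c-1))) z' = (kP n ^ ((3*n:ℕ) - (c:ℤ) - i - 1)) w := by
    rw [hz', ← Equiv.Perm.mul_apply, ← zpow_natCast, ← zpow_add]
    congr 2
    omega
  have e1 := kE_getD hn z c (by omega)
  rw [hzz, hM, if_pos (by omega)] at e1
  have e2 := kE_getD hn z' (c-1) (by omega)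
  rw [hzz', hM, if_neg (by omega)] at e2
  have e3 := PE_step hn w i
  rw [← hz, ← hz'] at e3
  rw [← e3, kP_apply hn, pro_getD hn (kE n z).2 (hit_ML hn (kE n z).2) (c-1) (by omega),
    show c - 1 + 1 = c by omega, e1] at e2
  split_ifs at e2 with h5
  · exact h5.symm
  · exact absurd e2 (hit_ML hn ((kP n ^ ((3*n:ℕ) - (c:ℤ) - i - 1)) w).2).hb

theorem main_eps {n : ℕ} (hn : 1 ≤ n) (w : KW n) (i : ℕ) (hi : i < 3 * n) :
    kL (pro^[i] (evacStar n w.1)) = kL (pro^[3*n-1-i] w.1) := by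
  rw [(main_star hn w i).2]
  set z := (kP n ^ (-(i:ℤ))) w with hz
  set z' := (kP n ^ (-((i+1:ℕ):ℤ))) w with hz'
  have e3 := PE_step hn w i
  rw [← hz, ← hz'] at e3
  have e1 := pro_getD_last hn (kE n z).2 (hit_ML hn (kE n z).2)
  have h1 := hit_ML hn z'.2
  have h2 := h1.mlt
  rw [z'.2.1] at h2
  rw [← kP_apply hn, e3, kE_getD hn z' _ le_rfl, Nat.sub_self, pow_zero, Equiv.Perm.one_apply,
    if_pos (by omega)] at e1
  rw [← e1, ← (kM_period hn z').2, ← kP_pow_apply hn, hz', ← Equiv.Perm.mul_apply,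
    ← zpow_natCast, ← zpow_natCast, ← zpow_add]
  congr 4
  omega

/-- `σ_{evac*(w)} = rc(σ_w⁻¹)`: for `i ∈ {1, …, 3n}`, with `j = σ_w⁻¹(3n+1-i)` we
have `σ_{evac*(w)}(i) = 3n + 1 - j`; moreover `ε_{evac*(w)}(i) = ε_w(3n+1-i)` for
all `i ∈ {1, …, 3n}`. -/
theorem ksigma_keps_evacStar (n : ℕ) (w : List KLetter) (hw : IsKrewerasWord n w) :
    (∀ i j : ℕ, 1 ≤ i → i ≤ 3 * n → 1 ≤ j → j ≤ 3 * n →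
      ksigma n w j = 3 * n + 1 - i →
      ksigma n (evacStar n w) i = 3 * n + 1 - j) ∧
    (∀ i : ℕ, 1 ≤ i → i ≤ 3 * n →
      keps (evacStar n w) i = keps w (3 * n + 1 - i)) := by
  rcases Nat.eq_zero_or_pos n with h0 | hn
  · subst h0
    exact ⟨fun i j h1 h2 => by omega, fun i h1 h2 => by omega⟩
  have hM : ∀ x, IsKrewerasWord n x → kiota x = kM x + 1 := fun x hx =>
    (hit_ML hn hx).iota hn hx
  have hes : IsKrewerasWord n (evacStar n w) := by
    rw [evacStar_apply hn ⟨w, hw⟩]; exact Subtype.property _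
  constructor
  · intro i j hi1 hi2 hj1 hj2 h
    unfold ksigma at h ⊢
    have hHl := (hit_ML hn (iter_kw hn hw (j-1))).mlt
    rw [(iter_kw hn hw (j-1)).1] at hHl
    rw [hM _ (iter_kw hn hw _)] at h
    rw [hM _ (iter_kw hn hes _)]
    rw [show kM (pro^[j-1] w) + 1 + j - 2 = kM (pro^[j-1] w) + (j-1) by omega] at h
    have key := main_sigma hn ⟨w, hw⟩ (i-1) (j-1) (by omega) (by omega) (by
      change (kM (pro^[j-1] w) + (j-1)) % (3 * n) = 3 * n - 1 - (i-1)
      omega)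
    change kM (pro^[i-1] (evacStar n w)) = kM (pro^[j-1] w) at key
    rw [key]
    generalize kM (pro^[j-1] w) = c at *
    rw [show c + 1 + i - 2 = c + (i-1) by omega]
    rcases Nat.lt_or_ge (c + (j-1)) (3*n) with h3 | h3
    · rw [Nat.mod_eq_of_lt h3] at h
      rw [Nat.mod_eq_of_lt (by omega)]
      omega
    · rw [Nat.mod_eq_sub_mod h3, Nat.mod_eq_of_lt (by omega)] at h
      rw [Nat.mod_eq_sub_mod (by omega), Nat.mod_eq_of_lt (by omega)]
      omega
  · intro i hi1 hi2
    have := main_eps hn ⟨w, hw⟩ (i-1) (by omega)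
    rw [show 3 * n - 1 - (i-1) = 3 * n + 1 - i - 1 by omega] at this
    exact this
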